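/- Let f ∈ S be a bihomogeneous element of degree (a, b) and R = S/fS the hypersurface ring. Then R has maximal depth with respect to Q if and only if one of the following holds: (a) f = h_1 h_2 h_3 where h_1, h_2, h_3 are bihomogeneous with deg h_1 = (α_1, 0), α_1 > 0, deg h_2 = (α_2, β_1) with α_2, β_1 > 0, deg h_3 = (0, β_2) with β_2 > 0, and α_1 + α_2 = a, β_1 + β_2 = b; (b) f = h_2 h_3 where deg h_2 = (α_2, β_1) with α_2 = a > 0 and β_1 > 0, deg h_3 = (0, β_2) with β_2 > 0, and β_1 + β_2 = b; (c) f = h_1 h_3 where deg h_1 = (a, 0) with a ≥ 0 and deg h_3 = (0, b) with b ≥ 0. -/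

import Mathlib

open CategoryTheory MvPolynomial

noncomputable section

/-- The standard bigraded polynomial ring `S = K[x_1,…,x_m, y_1,…,y_n]`. -/
abbrev BGS (K : Type) [Field K] (m n : ℕ) : Type := MvPolynomial (Fin m ⊕ Fin n) K

/-- The bigrading weights: `deg x_i = (1,0)`, `deg y_j = (0,1)`. -/
def bwt (m n : ℕ) : Fin m ⊕ Fin n → ℕ × ℕ := Sum.elim (fun _ => (1, 0)) (fun _ => (0, 1))

/-- `P = (x_1, …, x_m)`. -/
def idealP (K : Type) [Field K] (m n : ℕ) : Ideal (BGS K m n) :=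
  Ideal.span (Set.range fun i : Fin m => (X (Sum.inl i) : BGS K m n))

/-- `Q = (y_1, …, y_n)`. -/
def idealQ (K : Type) [Field K] (m n : ℕ) : Ideal (BGS K m n) :=
  Ideal.span (Set.range fun j : Fin n => (X (Sum.inr j) : BGS K m n))

/-- `cd(J, M)`: the cohomological dimension, i.e. the largest `i` such that the local
cohomology module `H^i_J(M)` is nonzero. -/
def cohDim (R : Type) [CommRing R] (J : Ideal R) (M : Type) [AddCommGroup M] [Module R M] : ℕ :=
  sSup {i : ℕ | Nontrivial ((localCohomology J i).obj (ModuleCat.of R M))}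

/-- `grade(J, M)`: the least `i` with `Ext^i(R/J, M) ≠ 0`. -/
def extGrade (R : Type) [CommRing R] (J : Ideal R) (M : Type) [AddCommGroup M] [Module R M] : ℕ :=
  sInf {i : ℕ | Nontrivial
    (((Ext R (ModuleCat R) i).obj (Opposite.op (ModuleCat.of R (R ⧸ J)))).obj (ModuleCat.of R M))}

/-- `mgrade(J, M) = min {cd(J, R/p) : p ∈ Ass(M)}`. -/
def mCohDim (R : Type) [CommRing R] (J : Ideal R) (M : Type) [AddCommGroup M] [Module R M] : ℕ :=
  sInf ((fun p => cohDim R J (R ⧸ p)) '' associatedPrimes R M)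

/-- `M` has maximal depth with respect to `J` if `grade(J, M) = mgrade(J, M)`. -/
def HasMaximalDepth (R : Type) [CommRing R] (J : Ideal R) (M : Type) [AddCommGroup M]
    [Module R M] : Prop :=
  extGrade R J M = mCohDim R J M

/-- A bigrading on an `S`-module `M`: an internal direct sum decomposition indexed by `ℕ × ℕ`
compatible with the bigrading of `S`. -/
structure IsBigrading (K : Type) [Field K] (m n : ℕ) (M : Type) [AddCommGroup M]
    [Module (BGS K m n) M] (ℳ : ℕ × ℕ → AddSubgroup M) : Prop where
  internal : DirectSum.IsInternal ℳ
  smul_mem : ∀ (d e : ℕ × ℕ) (s : BGS K m n) (x : M),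
    IsWeightedHomogeneous (bwt m n) s d → x ∈ ℳ e → s • x ∈ ℳ (d + e)

/-- A submodule is bigraded if it is generated by bihomogeneous elements. -/
def IsBigradedSubmodule (K : Type) [Field K] (m n : ℕ) {M : Type} [AddCommGroup M]
    [Module (BGS K m n) M] (ℳ : ℕ × ℕ → AddSubgroup M) (N : Submodule (BGS K m n) M) : Prop :=
  N = Submodule.span (BGS K m n) {x : M | x ∈ N ∧ ∃ d, x ∈ ℳ d}

section Helpers
open Opposite Limits Pointwise


section OldExt

variable {R : Type} [CommRing R]

/-- cocycle `v` represents the class `h` in the homology of a complex in the opposite category -/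
def ClsRel (K : ChainComplex (ModuleCat.{0} R)ᵒᵖ ℕ) (i : ℕ)
    (v : (K.X i).unop) (h : (K.homology i).unop) : Prop :=
  ∃ z : (K.opcycles i).unop, (K.pOpcycles i).unop z = v ∧ (K.homologyι i).unop z = h

lemma ClsRel.exists_left (K : ChainComplex (ModuleCat.{0} R)ᵒᵖ ℕ) (i : ℕ)
    (h : (K.homology i).unop) : ∃ v, ClsRel K i v h := by
  have : Function.Surjective (K.homologyι i).unop :=
    (ModuleCat.epi_iff_surjective _).mp inferInstance
  obtain ⟨z, hz⟩ := this h
  exact ⟨_, z, rfl, hz⟩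

lemma ClsRel.exists_right (K : ChainComplex (ModuleCat.{0} R)ᵒᵖ ℕ) (i : ℕ)
    (v : (K.X i).unop) (hv : (K.d (i+1) i).unop v = 0) : ∃ h, ClsRel K i v h := by
  have e := (ShortComplex.exact_of_g_is_cokernel
    (ShortComplex.mk (K.d (i+1) i) (K.pOpcycles i) (K.d_pOpcycles _ _))
    (K.opcyclesIsCokernel (i+1) i (by simp))).unop
  rw [ShortComplex.moduleCat_exact_iff] at e
  obtain ⟨z, hz⟩ := e v hv
  exact ⟨_, z, hz, rfl⟩

lemma ClsRel.cocycle {K : ChainComplex (ModuleCat.{0} R)ᵒᵖ ℕ} {i : ℕ}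
    {v : (K.X i).unop} {h : (K.homology i).unop} (H : ClsRel K i v h) :
    (K.d (i+1) i).unop v = 0 := by
  obtain ⟨z, rfl, -⟩ := H
  have := congrArg Quiver.Hom.unop (K.d_pOpcycles (i+1) i)
  exact congrArg (fun (f : (K.opcycles i).unop ⟶ (K.X (i+1)).unop) => f z) this

lemma ClsRel.eq_zero_iff {K : ChainComplex (ModuleCat.{0} R)ᵒᵖ ℕ} {i j : ℕ}
    (hj : (ComplexShape.down ℕ).next i = j)
    {v : (K.X i).unop} {h : (K.homology i).unop} (H : ClsRel K i v h) :
    h = 0 ↔ ∃ w : (K.X j).unop, (K.d i j).unop w = v := by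
  obtain ⟨z, rfl, rfl⟩ := H
  have e := (ShortComplex.exact_of_f_is_kernel
    (ShortComplex.mk (K.homologyι i) (K.fromOpcycles i j) (K.homologyι_comp_fromOpcycles _ _))
    (K.homologyIsKernel i j hj)).unop
  rw [ShortComplex.moduleCat_exact_iff] at e
  have pf : ∀ w, (K.d i j).unop w = (K.pOpcycles i).unop ((K.fromOpcycles i j).unop w) := by
    intro w
    have := congrArg Quiver.Hom.unop (K.p_fromOpcycles i j)
    exact (congrArg (fun (f : (K.X j).unop ⟶ (K.X i).unop) => f w) this).symm
  have inj : Function.Injective (K.pOpcycles i).unop :=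
    (ModuleCat.mono_iff_injective _).mp inferInstance
  constructor
  · intro h0
    obtain ⟨w, hw⟩ := e z h0
    exact ⟨w, (pf w).trans (congrArg _ hw)⟩
  · rintro ⟨w, hw⟩
    rw [pf] at hw
    rw [← inj hw]
    have := congrArg Quiver.Hom.unop (K.homologyι_comp_fromOpcycles i j)
    exact congrArg (fun (f : (K.X j).unop ⟶ (K.homology i).unop) => f w) this

lemma ClsRel.map {K L : ChainComplex (ModuleCat.{0} R)ᵒᵖ ℕ} (φ : K ⟶ L) {i : ℕ}
    {v : (L.X i).unop} {h : (L.homology i).unop} (H : ClsRel L i v h) :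
    ClsRel K i ((φ.f i).unop v) ((HomologicalComplex.homologyMap φ i).unop h) := by
  obtain ⟨z, rfl, rfl⟩ := H
  refine ⟨(HomologicalComplex.opcyclesMap φ i).unop z, ?_, ?_⟩
  · have := congrArg Quiver.Hom.unop (HomologicalComplex.p_opcyclesMap φ i)
    exact congrArg (fun (f : (L.opcycles i).unop ⟶ (K.X i).unop) => f z) this
  · have := congrArg Quiver.Hom.unop (HomologicalComplex.homologyι_naturality φ i)
    exact (congrArg (fun (f : (L.opcycles i).unop ⟶ (K.homology i).unop) => f z) this).symm

lemma ClsRel.of_eq {K : ChainComplex (ModuleCat.{0} R)ᵒᵖ ℕ} {i : ℕ}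
    {v v' : (K.X i).unop} {h h' : (K.homology i).unop} (H : ClsRel K i v h) (hv : v' = v)
    (hh : h' = h) : ClsRel K i v' h' := by
  subst hv hh; exact H

/-- the old Ext module -/
abbrev OExt (X Y : ModuleCat.{0} R) (i : ℕ) : Type :=
  ((Ext R (ModuleCat R) i).obj (op X)).obj Y

abbrev homF (Y : ModuleCat.{0} R) : ModuleCat.{0} R ⥤ (ModuleCat.{0} R)ᵒᵖ :=
  ((linearYoneda R (ModuleCat.{0} R)).obj Y).rightOp

/-- `f` is a cocycle representing `ξ`. -/
def ORel {X Y : ModuleCat.{0} R} (P : ProjectiveResolution X) {i : ℕ} (f : P.complex.X i ⟶ Y)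
    (ξ : OExt X Y i) : Prop :=
  ClsRel (((homF Y).mapHomologicalComplex _).obj P.complex) i f
    ((P.isoLeftDerivedObj (homF Y) i).inv.unop ξ)

lemma ORel.exists_left {X Y : ModuleCat.{0} R} (P : ProjectiveResolution X) {i : ℕ}
    (ξ : OExt X Y i) : ∃ f, ORel P f ξ :=
  ClsRel.exists_left (((homF Y).mapHomologicalComplex _).obj P.complex) i
    ((P.isoLeftDerivedObj (homF Y) i).inv.unop ξ)

lemma ORel.exists_right {X Y : ModuleCat.{0} R} (P : ProjectiveResolution X) {i : ℕ}
    (f : P.complex.X i ⟶ Y) (hf : P.complex.d (i+1) i ≫ f = 0) :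
    ∃ ξ : OExt X Y i, ORel P f ξ := by
  obtain ⟨h, hh⟩ := ClsRel.exists_right (((homF Y).mapHomologicalComplex _).obj P.complex) i f hf
  refine ⟨(P.isoLeftDerivedObj (homF Y) i).hom.unop h, ?_⟩
  refine ClsRel.of_eq hh rfl ?_
  have := congrArg Quiver.Hom.unop (P.isoLeftDerivedObj (homF Y) i).inv_hom_id
  exact congrArg (fun f => f.hom h) this

lemma ORel.cocycle {X Y : ModuleCat.{0} R} {P : ProjectiveResolution X} {i : ℕ}
    {f : P.complex.X i ⟶ Y} {ξ : OExt X Y i} (H : ORel P f ξ) :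
    P.complex.d (i+1) i ≫ f = 0 := ClsRel.cocycle H

lemma ORel.eq_zero_iff {X Y : ModuleCat.{0} R} {P : ProjectiveResolution X} {i j : ℕ}
    (hj : (ComplexShape.down ℕ).next i = j)
    {f : P.complex.X i ⟶ Y} {ξ : OExt X Y i} (H : ORel P f ξ) :
    ξ = 0 ↔ ∃ g : P.complex.X j ⟶ Y, P.complex.d i j ≫ g = f := by
  refine Iff.trans ?_ (ClsRel.eq_zero_iff hj H)
  have inj : Function.Injective (P.isoLeftDerivedObj (homF Y) i).inv.unop :=
    (ModuleCat.mono_iff_injective _).mp inferInstance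
  constructor
  · rintro rfl
    exact map_zero _
  · intro h
    exact inj (h.trans (map_zero _).symm)

lemma ORel.map {X X' Y : ModuleCat.{0} R} {P : ProjectiveResolution X}
    {P' : ProjectiveResolution X'} {g : X' ⟶ X} (φ : P'.Hom P g) {i : ℕ}
    {f : P.complex.X i ⟶ Y} {ξ : OExt X Y i} (H : ORel P f ξ) :
    ORel P' (φ.hom.f i ≫ f) (((Ext R (ModuleCat R) i).map g.op).app Y ξ) := by
  have h1 := ClsRel.map (((homF Y).mapHomologicalComplex _).map φ.hom) H
  refine ClsRel.of_eq h1 rfl ?_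
  have := congrArg Quiver.Hom.unop (ProjectiveResolution.isoLeftDerivedObj_inv_naturality g P' P φ.hom
    (by simpa using φ.hom_f_zero_comp_π_f_zero) (homF Y) i)
  exact congrArg (fun f => f.hom ξ) this

/-- New Ext class zero iff coboundary, including degree 0. -/
lemma extMk_eq_zero_iff' {X Y : ModuleCat.{0} R} (P : ProjectiveResolution X) {i j : ℕ}
    (hj : (ComplexShape.down ℕ).next i = j) (f : P.complex.X i ⟶ Y)
    (hf : P.complex.d (i+1) i ≫ f = 0) :
    P.extMk f (i+1) rfl hf = 0 ↔ ∃ g : P.complex.X j ⟶ Y, P.complex.d i j ≫ g = f := by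
  cases i with
  | succ p =>
    have : j = p := by simpa using hj.symm
    subst this
    exact P.extMk_eq_zero_iff f _ rfl hf _ rfl
  | zero =>
    have : j = 0 := by simpa using hj.symm
    subst this
    simp only [← P.extEquivCohomologyClass.apply_eq_iff_eq,
      ProjectiveResolution.extEquivCohomologyClass_extMk,
      ProjectiveResolution.extEquivCohomologyClass_zero,
      CochainComplex.HomComplex.CohomologyClass.mk_eq_zero_iff]
    rw [CochainComplex.HomComplex.Cocycle.toSingleMk_mem_coboundaries_iff _ _ _ _ _ 1 (by simp)]
    have h1 : P.cochainComplex.d (-(0:ℕ)) 1 = 0 := by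
      apply IsZero.eq_of_tgt
      exact P.cochainComplex.isZero_of_isStrictlyLE 0 1 (by lia)
    rw [h1]
    simp only [zero_comp, exists_const, HomologicalComplex.shape _ _ _ (show ¬ (ComplexShape.down ℕ).Rel 0 0 by simp)]
    constructor
    · intro hg
      rw [← cancel_epi (P.cochainComplexXIso (-(0:ℕ)) 0 rfl).hom, ← hg]; simp
    · intro hg
      rw [← hg]; simp

/-- Old and new Ext classes correspond. -/
def NRel {X Y : ModuleCat.{0} R} {i : ℕ} (ξ : OExt X Y i) (η : Abelian.Ext X Y i) : Prop :=
  ∃ (f : (projectiveResolution X).complex.X i ⟶ Y)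
    (hf : (projectiveResolution X).complex.d (i+1) i ≫ f = 0),
    ORel (projectiveResolution X) f ξ ∧ (projectiveResolution X).extMk f (i+1) rfl hf = η

lemma NRel.exists_new {X Y : ModuleCat.{0} R} {i : ℕ} (ξ : OExt X Y i) :
    ∃ η : Abelian.Ext X Y i, NRel ξ η := by
  obtain ⟨f, hf⟩ := ORel.exists_left (projectiveResolution X) ξ
  exact ⟨_, f, hf.cocycle, hf, rfl⟩

lemma NRel.exists_old {X Y : ModuleCat.{0} R} {i : ℕ} (η : Abelian.Ext X Y i) :
    ∃ ξ : OExt X Y i, NRel ξ η := by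
  obtain ⟨f, hf, rfl⟩ := (projectiveResolution X).extMk_surjective η (i+1) rfl
  obtain ⟨ξ, hξ⟩ := ORel.exists_right _ f hf
  exact ⟨ξ, f, hf, hξ, rfl⟩

lemma NRel.eq_zero_iff {X Y : ModuleCat.{0} R} {i : ℕ} {ξ : OExt X Y i} {η : Abelian.Ext X Y i}
    (H : NRel ξ η) : ξ = 0 ↔ η = 0 := by
  obtain ⟨f, hf, h, rfl⟩ := H
  rw [h.eq_zero_iff rfl, extMk_eq_zero_iff' _ rfl]

lemma NRel.map {X X' Y : ModuleCat.{0} R} {i : ℕ} {ξ : OExt X Y i} {η : Abelian.Ext X Y i}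
    (H : NRel ξ η) (g : X' ⟶ X) :
    NRel (((Ext R (ModuleCat R) i).map g.op).app Y ξ)
      ((Abelian.Ext.mk₀ g).comp η (zero_add i)) := by
  obtain ⟨f, hf, h, rfl⟩ := H
  let φ : (projectiveResolution X').Hom (projectiveResolution X) g :=
    ⟨ProjectiveResolution.lift g _ _, ProjectiveResolution.lift_commutes_zero g _ _⟩
  exact ⟨_, _, h.map φ, (ProjectiveResolution.mk₀_comp_extMk f _ rfl hf φ).symm⟩

lemma nontrivial_oExt_iff (X Y : ModuleCat.{0} R) (i : ℕ) :
    Nontrivial (OExt X Y i) ↔ Nontrivial (Abelian.Ext X Y i) := by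
  constructor
  · intro h
    obtain ⟨ξ, hξ⟩ := exists_ne (0 : OExt X Y i)
    obtain ⟨η, hη⟩ := NRel.exists_new ξ
    exact ⟨η, 0, fun h => hξ (hη.eq_zero_iff.mpr h)⟩
  · intro h
    obtain ⟨ξ, hξ⟩ := exists_ne (0 : Abelian.Ext X Y i)
    obtain ⟨η, hη⟩ := NRel.exists_old ξ
    exact ⟨η, 0, fun h => hξ (hη.eq_zero_iff.mp h)⟩

end OldExt


section LC
variable {R : Type} [CommRing R]

/-- canonical map of cyclic modules -/
def canQ {I J : Ideal R} (h : I ≤ J) : ModuleCat.of R (R ⧸ I) ⟶ ModuleCat.of R (R ⧸ J) :=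
  ModuleCat.ofHom (Submodule.mapQ I J LinearMap.id h)

lemma canQ_comp {I J L : Ideal R} (h : I ≤ J) (h' : J ≤ L) :
    canQ h ≫ canQ h' = canQ (h.trans h') := by
  ext x; rfl

lemma canQ_surj {I J : Ideal R} (h : I ≤ J) : Function.Surjective (canQ h) := by
  intro x
  obtain ⟨y, rfl⟩ := Submodule.Quotient.mk_surjective _ x
  exact ⟨Submodule.Quotient.mk y, rfl⟩

lemma canQ_refl {I : Ideal R} (h : I ≤ I) : canQ h = 𝟙 _ := by
  ext x; rfl

/-- the diagram evaluated at `M` -/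
abbrev lcD (J : Ideal R) (i : ℕ) (M : ModuleCat.{0} R) : (ℕᵒᵖ)ᵒᵖ ⥤ ModuleCat.{0} R :=
  localCohomology.diagram (localCohomology.idealPowersDiagram J) i ⋙
    (evaluation _ _).obj M

lemma lc_equiv (J : Ideal R) (i : ℕ) (M : ModuleCat.{0} R) :
    Nonempty ((localCohomology J i).obj M ≅ colimit (lcD J i M)) :=
  ⟨colimitObjIsoColimitCompEvaluation
    (localCohomology.diagram (localCohomology.idealPowersDiagram J) i) M⟩

lemma lc_nontrivial_iff (J : Ideal R) (i : ℕ) (M : ModuleCat.{0} R) :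
    Nontrivial ((localCohomology J i).obj M) ↔
      Nontrivial ((colimit (lcD J i M) : ModuleCat.{0} R)) := by
  obtain ⟨e⟩ := lc_equiv J i M
  exact e.toLinearEquiv.toEquiv.nontrivial_congr

lemma lc_not_nontrivial (J : Ideal R) (i : ℕ) (M : ModuleCat.{0} R)
    (H : ∀ t, ∀ ξ : Abelian.Ext (ModuleCat.of R (R ⧸ J ^ t)) M i, ∃ t', ∃ h : t ≤ t',
      (Abelian.Ext.mk₀ (canQ (Ideal.pow_le_pow_right (I := J) h))).comp ξ (zero_add i) = 0) :
    ¬ Nontrivial ((localCohomology J i).obj M) := by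
  rw [lc_nontrivial_iff, not_nontrivial_iff_subsingleton]
  refine subsingleton_of_forall_eq 0 fun x => ?_
  obtain ⟨j, y, rfl⟩ := Concrete.colimit_exists_rep (lcD J i M) x
  obtain ⟨η, hη⟩ := NRel.exists_new (i := i) (X := ModuleCat.of R (R ⧸ J ^ (unop (unop j))))
    (Y := M) y
  obtain ⟨t', h, h0⟩ := H _ η
  have h1 := hη.map (canQ (Ideal.pow_le_pow_right (I := J) h))
  have h2 := h1.eq_zero_iff.mpr h0
  let w : j ⟶ op (op t') := (homOfLE h).op.op
  have h3 : (lcD J i M).map w y = 0 := h2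
  rw [← colimit.w (lcD J i M) w, ModuleCat.comp_apply, h3, map_zero]

lemma lc_nontrivial (J : Ideal R) (i : ℕ) (M : ModuleCat.{0} R)
    (t : ℕ) (ξ : Abelian.Ext (ModuleCat.of R (R ⧸ J ^ t)) M i)
    (H : ∀ t', ∀ h : t ≤ t',
      (Abelian.Ext.mk₀ (canQ (Ideal.pow_le_pow_right (I := J) h))).comp ξ (zero_add i) ≠ 0) :
    Nontrivial ((localCohomology J i).obj M) := by
  rw [lc_nontrivial_iff]
  obtain ⟨y, hy⟩ := NRel.exists_old ξ
  let j : (ℕᵒᵖ)ᵒᵖ := op (op t)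
  refine ⟨colimit.ι (lcD J i M) j y, 0, fun h0 => ?_⟩
  have h0' : colimit.ι (lcD J i M) j y = colimit.ι (lcD J i M) j 0 := by rw [h0, map_zero]
  obtain ⟨k, f, g, hfg⟩ := Concrete.colimit_exists_of_rep_eq (C := ModuleCat.{0} R) _ _ _ h0'
  rw [map_zero] at hfg
  have hle : t ≤ unop (unop k) := f.unop.unop.down.down
  exact H _ hle ((hy.map (canQ (Ideal.pow_le_pow_right (I := J) hle))).eq_zero_iff.mp hfg)
end LC


section HGs
variable {R : Type} [CommRing R]

/-- `Ext^i(R/J, M)` vanishes for `i < g` and is nonzero for `i = g`. -/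
def HG (J : Ideal R) (M : ModuleCat.{0} R) (g : ℕ) : Prop :=
  (∀ i < g, ∀ ξ : Abelian.Ext (ModuleCat.of R (R ⧸ J)) M i, ξ = 0) ∧
    ∃ ξ : Abelian.Ext (ModuleCat.of R (R ⧸ J)) M g, ξ ≠ 0

lemma HG.extGrade_eq {J : Ideal R} {M : Type} [AddCommGroup M] [Module R M] {g : ℕ}
    (h : HG J (ModuleCat.of R M) g) : extGrade R J M = g := by
  unfold extGrade
  apply le_antisymm
  · apply Nat.sInf_le
    obtain ⟨ξ, hξ⟩ := h.2
    exact (nontrivial_oExt_iff _ _ _).mpr ⟨ξ, 0, hξ⟩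
  · apply le_csInf
    · obtain ⟨ξ, hξ⟩ := h.2
      exact ⟨g, (nontrivial_oExt_iff _ _ _).mpr ⟨ξ, 0, hξ⟩⟩
    · intro i hi
      by_contra hlt
      obtain ⟨ξ, hξ⟩ := @exists_ne _ ((nontrivial_oExt_iff _ _ _).mp hi) 0
      exact hξ (h.1 i (not_le.mp hlt) ξ)

lemma ext_comp_eq_zero_left {X Y Z : ModuleCat.{0} R} {a b c : ℕ} {α : Abelian.Ext X Y a}
    (β : Abelian.Ext Y Z b) (h : a + b = c) (hα : α = 0) : α.comp β h = 0 := by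
  rw [hα, Abelian.Ext.zero_comp]

lemma ext_comp_eq_zero_right {X Y Z : ModuleCat.{0} R} {a b c : ℕ} (α : Abelian.Ext X Y a)
    {β : Abelian.Ext Y Z b} (h : a + b = c) (hβ : β = 0) : α.comp β h = 0 := by
  rw [hβ, Abelian.Ext.comp_zero]

/-- the kernel short complex of a morphism -/
def kerSC {M' M : ModuleCat.{0} R} (p : M' ⟶ M) : ShortComplex (ModuleCat.{0} R) :=
  ShortComplex.mk
    (ModuleCat.ofHom (LinearMap.ker p.hom).subtype :
      ModuleCat.of R (LinearMap.ker p.hom) ⟶ M') p (by ext x; exact x.2)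

lemma kerSC_shortExact {M' M : ModuleCat.{0} R} (p : M' ⟶ M) (hp : Function.Surjective p) :
    (kerSC p).ShortExact := by
  have h1 : (kerSC p).Exact := by
    rw [ShortComplex.moduleCat_exact_iff]
    intro x hx
    exact ⟨⟨x, hx⟩, rfl⟩
  have h2 : Mono (kerSC p).f :=
    (ModuleCat.mono_iff_injective (kerSC p).f).mpr (Subtype.val_injective)
  have h3 : Epi (kerSC p).g := (ModuleCat.epi_iff_surjective (kerSC p).g).mpr hp
  exact ShortComplex.ShortExact.mk' h1 h2 h3

lemma ext_postcomp_smul_zero {N M : ModuleCat.{0} R} {x : R} (hx : x ∈ Module.annihilator R N)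
    {i : ℕ} (ξ : Abelian.Ext N M i) :
    ξ.comp (Abelian.Ext.mk₀ (M.smulShortComplex x).f) (add_zero i) = 0 := by
  have h := Abelian.Ext.postcomp_smul_id_eq_zero_of_mem_annihilator (M := M) (N := N) hx i
  have := ConcreteCategory.congr_hom h ξ
  rw [ModuleCat.smulShortComplex_f_eq_smul_id]
  exact this

lemma mem_ann_quot {J : Ideal R} {x : R} (hx : x ∈ J) :
    x ∈ Module.annihilator R (ModuleCat.of R (R ⧸ J)) := by
  have := Ideal.annihilator_quotient (I := J)
  change x ∈ Module.annihilator R (R ⧸ J)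
  rwa [this]

lemma HG.step {J : Ideal R} {M : ModuleCat.{0} R} {g : ℕ} {x : R} (hx : x ∈ J)
    (reg : IsSMulRegular M x) (h : HG J (ModuleCat.of R (QuotSMulTop x M)) g) : HG J M (g+1) := by
  have hS := reg.smulShortComplex_shortExact
  have A : ∀ i < g+1, ∀ ξ : Abelian.Ext (ModuleCat.of R (R ⧸ J)) M i, ξ = 0 := by
    intro i hi ξ
    have h0 := ext_postcomp_smul_zero (M := M) (mem_ann_quot hx) ξ
    cases i with
    | zero =>
      have := hS.mono_f
      have inj := Abelian.Ext.postcomp_mk₀_injective_of_mono (ModuleCat.of R (R ⧸ J))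
        (M.smulShortComplex x).f
      exact inj (Eq.trans h0 (map_zero _).symm)
    | succ k =>
      obtain ⟨x₃, rfl⟩ := Abelian.Ext.covariant_sequence_exact₁ _ hS ξ h0 rfl
      exact ext_comp_eq_zero_left _ _ (h.1 k (by omega) x₃)
  refine ⟨A, ?_⟩
  obtain ⟨ξ, hξ⟩ := h.2
  refine ⟨Abelian.Ext.comp ξ hS.extClass rfl, fun h0 => hξ ?_⟩
  obtain ⟨x₂, rfl⟩ := Abelian.Ext.covariant_sequence_exact₃ _ hS ξ rfl h0
  exact ext_comp_eq_zero_left _ _ (A g (by omega) x₂)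

lemma HG.unstep {J : Ideal R} {M : ModuleCat.{0} R} {g : ℕ} {x : R} (hx : x ∈ J)
    (reg : IsSMulRegular M x) (h : HG J M (g+1)) : HG J (ModuleCat.of R (QuotSMulTop x M)) g := by
  have hS := reg.smulShortComplex_shortExact
  constructor
  · intro i hi ξ
    obtain ⟨x₂, hx₂⟩ := Abelian.Ext.covariant_sequence_exact₃ (ModuleCat.of R (R ⧸ J)) hS ξ rfl
      (h.1 (i+1) (by omega) _)
    exact hx₂.symm.trans (ext_comp_eq_zero_left _ _ (h.1 i (by omega) x₂))
  · obtain ⟨ξ, hξ⟩ := h.2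
    have h0 := ext_postcomp_smul_zero (M := M) (mem_ann_quot hx) ξ
    obtain ⟨x₃, rfl⟩ := Abelian.Ext.covariant_sequence_exact₁ _ hS ξ h0 rfl
    exact ⟨x₃, fun h0 => hξ (ext_comp_eq_zero_left _ _ h0)⟩

lemma HG.of_iso {J : Ideal R} {M M' : ModuleCat.{0} R} {g : ℕ} (e : M ≅ M') (h : HG J M g) :
    HG J M' g := by
  have key : ∀ (A B : ModuleCat.{0} R) (e : A ≅ B) (i : ℕ)
    (ξ : Abelian.Ext (ModuleCat.of R (R ⧸ J)) A i),
      ξ.comp (Abelian.Ext.mk₀ e.hom) (add_zero i) = 0 → ξ = 0 := by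
    intro A B e i ξ h
    have := congrArg (fun η => Abelian.Ext.comp η (Abelian.Ext.mk₀ e.inv) (add_zero i)) h
    simpa using this
  constructor
  · intro i hi ξ
    exact key _ _ e.symm _ _ (h.1 i hi _)
  · obtain ⟨ξ, hξ⟩ := h.2
    exact ⟨ξ.comp (Abelian.Ext.mk₀ e.hom) (add_zero g), fun h => hξ (key _ _ e _ _ h)⟩

lemma HG.base {J : Ideal R} {M : ModuleCat.{0} R} (v : M) (hv : v ≠ 0)
    (h : ∀ x ∈ J, x • v = 0) : HG J M 0 := by
  refine ⟨by simp, ?_⟩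
  let φ : (R ⧸ J) →ₗ[R] M := Submodule.liftQ J (LinearMap.toSpanSingleton R M v)
    (fun x hx => h x hx)
  refine ⟨Abelian.Ext.mk₀ (ModuleCat.ofHom φ), fun h0 => hv ?_⟩
  rw [Abelian.Ext.mk₀_eq_zero_iff] at h0
  have := ConcreteCategory.congr_hom h0 (Submodule.Quotient.mk 1)
  have h1 : φ (Submodule.Quotient.mk 1) = v := one_smul R v
  exact h1.symm.trans this

/-- vanishing below the grade for all modules supported on `V(J)` -/
lemma HG.vanish [IsNoetherianRing R] {J : Ideal R} {M : ModuleCat.{0} R} [Module.Finite R M]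
    {g : ℕ} (h : HG J M g) (hlt : J • (⊤ : Submodule R M) < ⊤) (N : ModuleCat.{0} R)
    [Module.Finite R N] (t : ℕ) (hN : ∀ x ∈ J ^ t, ∀ v : N, x • v = 0) :
    ∀ i < g, ∀ ξ : Abelian.Ext N M i, ξ = 0 := by
  obtain ⟨rs, len, mem, reg⟩ := ModuleCat.exists_isRegular_of_exists_subsingleton_ext J g M hlt
    (ModuleCat.of R (R ⧸ J))
    (by
      change Module.support R (R ⧸ J) = _
      rw [Module.support_eq_zeroLocus, Ideal.annihilator_quotient])
    (fun i hi => subsingleton_of_forall_eq 0 (h.1 i hi))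
  intro i hi ξ
  have := ModuleCat.subsingleton_ext_of_exists_isRegular J N
    (by
      rw [Module.support_eq_zeroLocus, PrimeSpectrum.zeroLocus_subset_zeroLocus_iff]
      intro x hx
      refine ⟨t, ?_⟩
      rw [Module.mem_annihilator]
      exact hN _ (Ideal.pow_mem_pow hx t)) M hlt rs mem reg i (by omega)
  exact Subsingleton.elim _ _

/-- transition maps are injective in degree `g` -/
lemma HG.inj [IsNoetherianRing R] {J : Ideal R} {M : ModuleCat.{0} R} [Module.Finite R M]
    {g : ℕ} (h : HG J M g) (hlt : J • (⊤ : Submodule R M) < ⊤) (t t' : ℕ) (htt : t ≤ t')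
    (ξ : Abelian.Ext (ModuleCat.of R (R ⧸ J ^ t)) M g)
    (h0 : (Abelian.Ext.mk₀ (canQ (Ideal.pow_le_pow_right (I := J) htt))).comp ξ (zero_add g) = 0) :
    ξ = 0 := by
  set p := canQ (Ideal.pow_le_pow_right (I := J) htt) with hp
  have : Epi p := (ModuleCat.epi_iff_surjective _).mpr (canQ_surj _)
  cases g with
  | zero =>
    apply Abelian.Ext.precomp_mk₀_injective_of_epi M p
    rw [map_zero]; exact h0
  | succ g =>
    have hS := kerSC_shortExact p (canQ_surj _)
    let N := ModuleCat.of R (LinearMap.ker p.hom)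
    obtain ⟨x₁, rfl⟩ := Abelian.Ext.contravariant_sequence_exact₃ hS _ ξ h0 (add_comm 1 g)
    have : Module.Finite R N := by
      have : IsNoetherian R (ModuleCat.of R (R ⧸ J ^ t')) :=
        inferInstanceAs (IsNoetherian R (R ⧸ J ^ t'))
      change Module.Finite R (LinearMap.ker p.hom)
      infer_instance
    have := h.vanish hlt N t' (by
      intro x hx v
      apply Subtype.ext
      obtain ⟨⟨v⟩, hv⟩ := v
      change x • Submodule.Quotient.mk v = 0
      rw [← Submodule.Quotient.mk_smul, Submodule.Quotient.mk_eq_zero]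
      exact Ideal.mul_mem_right _ _ hx) g (by omega) x₁
    exact ext_comp_eq_zero_right _ _ this

lemma HG.stage1 {J : Ideal R} {M : ModuleCat.{0} R} {g : ℕ} (h : HG J M g) :
    ∃ ξ : Abelian.Ext (ModuleCat.of R (R ⧸ J ^ 1)) M g, ξ ≠ 0 := by
  have := h.2
  rwa [show J = J ^ 1 from (pow_one J).symm] at this

lemma HG.lc_nontrivial [IsNoetherianRing R] {J : Ideal R} {M : ModuleCat.{0} R} [Module.Finite R M]
    {g : ℕ} (h : HG J M g) (hlt : J • (⊤ : Submodule R M) < ⊤) :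
    Nontrivial ((localCohomology J g).obj M) := by
  obtain ⟨ξ, hξ⟩ := h.stage1
  exact _root_.lc_nontrivial J g M 1 ξ (fun t' ht h0 => hξ (h.inj hlt _ _ ht ξ h0))

/-- top degree: lifting along a surjection `M' → M`. -/
lemma HG.lc_nontrivial_of_surj [IsNoetherianRing R] {J : Ideal R} {M M' : ModuleCat.{0} R}
    [Module.Finite R M]
    {g : ℕ} (h : HG J M g) (hlt : J • (⊤ : Submodule R M) < ⊤) (p : M' ⟶ M)
    (hp : Function.Surjective p)
    (hv : ∀ (N : ModuleCat.{0} R) (ξ : Abelian.Ext (ModuleCat.of R (R ⧸ J)) N (g+1)), ξ = 0) :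
    Nontrivial ((localCohomology J g).obj M') := by
  have : Epi p := (ModuleCat.epi_iff_surjective _).mpr hp
  have hS := kerSC_shortExact p hp
  rw [show J = J ^ 1 from (pow_one J).symm] at hv
  obtain ⟨η, hη⟩ := h.stage1
  obtain ⟨ξ, hξ⟩ := Abelian.Ext.covariant_sequence_exact₃ _ hS η rfl (hv _ _)
  rw [pow_one] at hv
  refine _root_.lc_nontrivial J g M' 1 ξ (fun t' ht h0 => hη (h.inj hlt _ _ ht η ?_))
  have h1 := Abelian.Ext.comp_assoc
    (Abelian.Ext.mk₀ (canQ (Ideal.pow_le_pow_right (I := J) ht))) ξ (Abelian.Ext.mk₀ (kerSC p).g)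
    (zero_add g) (add_zero g) (show 0 + g + 0 = g by omega)
  have h2 := h1.symm.trans (ext_comp_eq_zero_left _ _ h0)
  rw [← hξ]
  exact h2

end HGs


section Kos
variable {R : Type} [CommRing R]

lemma ext_smul_zero_left {X M : ModuleCat.{0} R} {c : R} (h : ∀ v : X, c • v = 0) {i : ℕ}
    (ξ : Abelian.Ext X M i) : c • ξ = 0 := by
  have h1 : c • 𝟙 X = 0 := by ext v; exact h v
  have : c • ξ = (Abelian.Ext.mk₀ (c • 𝟙 X)).comp ξ (zero_add i) := by
    simp [Abelian.Ext.mk₀_smul]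
  rw [this, h1]; simp

lemma ext_smul_zero_right {X M : ModuleCat.{0} R} {c : R} (h : ∀ v : M, c • v = 0) {i : ℕ}
    (ξ : Abelian.Ext X M i) : c • ξ = 0 := by
  have h1 : c • 𝟙 M = 0 := by ext v; exact h v
  have : c • ξ = ξ.comp (Abelian.Ext.mk₀ (c • 𝟙 M)) (add_zero i) := by
    simp [Abelian.Ext.mk₀_smul]
  rw [this, h1]; simp

/-- ideals generated by powers of the first `k` elements -/
def kI (y : ℕ → R) (k t : ℕ) : Ideal R := Ideal.span ((fun j => y j ^ t) '' {j | j < k})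

lemma kI_zero (y : ℕ → R) (t : ℕ) : kI y 0 t = ⊥ := by simp [kI]

lemma kI_le_succ (y : ℕ → R) (k t : ℕ) : kI y k t ≤ kI y (k+1) t :=
  Ideal.span_mono (Set.image_mono fun j (hj : j < k) => show j < k + 1 by omega)

lemma mem_kI_succ (y : ℕ → R) (k t : ℕ) (x : R) :
    x ∈ kI y (k+1) t ↔ ∃ r, x - r * y k ^ t ∈ kI y k t := by
  have : kI y (k+1) t = Ideal.span {y k ^ t} ⊔ kI y k t := by
    unfold kI
    rw [← Ideal.span_union]
    congr 1
    ext z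
    simp only [Set.mem_image, Set.mem_setOf_eq, Set.mem_union, Set.mem_singleton_iff]
    constructor
    · rintro ⟨j, hj, rfl⟩
      rcases Nat.lt_succ_iff_lt_or_eq.mp hj with h | rfl
      · exact Or.inr ⟨j, h, rfl⟩
      · exact Or.inl rfl
    · rintro (rfl | ⟨j, hj, rfl⟩)
      · exact ⟨k, by omega, rfl⟩
      · exact ⟨j, by omega, rfl⟩
  rw [this, Ideal.mem_span_singleton_sup]
  constructor
  · rintro ⟨a, b, hb, rfl⟩
    exact ⟨a, by simpa using hb⟩
  · rintro ⟨r, hr⟩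
    exact ⟨r, _, hr, by ring⟩

lemma kI_mono (y : ℕ → R) (k t s : ℕ) : kI y k (t + s) ≤ kI y k t := by
  unfold kI
  rw [Ideal.span_le]
  rintro _ ⟨j, hj, rfl⟩
  rw [SetLike.mem_coe]
  simp only [pow_add]
  exact Ideal.mul_mem_right _ _ (Ideal.subset_span ⟨j, hj, rfl⟩)

abbrev kQ (y : ℕ → R) (k t : ℕ) : ModuleCat.{0} R := ModuleCat.of R (R ⧸ kI y k t)

lemma kQ_ann (y : ℕ → R) (k t : ℕ) (c : R) (hc : c ∈ kI y k t) (v : kQ y k t) : c • v = 0 := by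
  obtain ⟨v, rfl⟩ := Submodule.Quotient.mk_surjective _ v
  rw [← Submodule.Quotient.mk_smul]
  exact (Submodule.Quotient.mk_eq_zero _).mpr (Ideal.mul_mem_right _ _ hc)

/-- the Koszul-type short complex -/
def kSC (y : ℕ → R) (k t : ℕ) : ShortComplex (ModuleCat.{0} R) :=
  ShortComplex.mk (X₁ := kQ y k t) (X₂ := kQ y k t) (X₃ := kQ y (k+1) t)
    (y k ^ t • 𝟙 _) (canQ (kI_le_succ y k t)) (by
      ext
      change Submodule.Quotient.mk (y k ^ t • (1 : R)) = (0 : R ⧸ kI y (k+1) t)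
      rw [Submodule.Quotient.mk_eq_zero, mem_kI_succ]
      exact ⟨1, by simp⟩)

lemma kSC_shortExact (y : ℕ → R) (k t : ℕ) (h : IsSMulRegular (R ⧸ kI y k t) (y k ^ t)) :
    (kSC y k t).ShortExact := by
  have h1 : (kSC y k t).Exact := by
    rw [ShortComplex.moduleCat_exact_iff]
    intro (x : R ⧸ kI y k t) hx
    obtain ⟨x, rfl⟩ := Submodule.Quotient.mk_surjective _ x
    have hx' : (Submodule.Quotient.mk x : R ⧸ kI y (k+1) t) = 0 := hx
    rw [Submodule.Quotient.mk_eq_zero, mem_kI_succ] at hx'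
    obtain ⟨r, hr⟩ := hx'
    refine ⟨(Submodule.Quotient.mk r : R ⧸ kI y k t), ?_⟩
    change (Submodule.Quotient.mk (y k ^ t • r) : R ⧸ kI y k t) = Submodule.Quotient.mk x
    rw [eq_comm, Submodule.Quotient.eq]
    simpa [mul_comm] using hr
  have h2 : Mono (kSC y k t).f := (ModuleCat.mono_iff_injective (kSC y k t).f).mpr h
  have h3 : Epi (kSC y k t).g := (ModuleCat.epi_iff_surjective (kSC y k t).g).mpr (canQ_surj _)
  exact ShortComplex.ShortExact.mk' h1 h2 h3

open Classical in
/-- extension class -/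
def kδ (y : ℕ → R) (k t : ℕ) : Abelian.Ext (kQ y (k+1) t) (kQ y k t) 1 :=
  if h : (kSC y k t).ShortExact then h.extClass else 0

lemma kδ_eq (y : ℕ → R) (k t : ℕ) (h : (kSC y k t).ShortExact) : kδ y k t = h.extClass := by
  exact dif_pos h

instance (y : ℕ → R) (t : ℕ) : Projective (kQ y 0 t) := by
  have e : R ≃ₗ[R] (R ⧸ kI y 0 t) :=
    (Submodule.quotEquivOfEqBot _ (kI_zero y t)).symm
  have : Module.Projective R (R ⧸ kI y 0 t) := Module.Projective.of_equiv e
  exact ModuleCat.projective_of_categoryTheory_projective (kQ y 0 t)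

def kU0 (y : ℕ → R) (t : ℕ) : kQ y 0 t ⟶ ModuleCat.of R R :=
  ModuleCat.ofHom (Submodule.quotEquivOfEqBot _ (kI_zero y t)).toLinearMap

/-- universal class -/
def kU (y : ℕ → R) : (k t : ℕ) → Abelian.Ext (kQ y k t) (ModuleCat.of R R) k
  | 0, t => Abelian.Ext.mk₀ (kU0 y t)
  | k+1, t => (kδ y k t).comp (kU y k t) (add_comm 1 k)

lemma k_vanish (y : ℕ → R) (n t : ℕ)
    (hreg : ∀ k < n, IsSMulRegular (R ⧸ kI y k t) (y k ^ t)) (M : ModuleCat.{0} R) (k : ℕ)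
    (hk : k ≤ n) : ∀ i, k < i → ∀ ξ : Abelian.Ext (kQ y k t) M i, ξ = 0 := by
  induction k with
  | zero =>
    intro i hi ξ
    obtain ⟨j, rfl⟩ : ∃ j, i = j + 1 := ⟨i - 1, by omega⟩
    exact ξ.eq_zero_of_projective
  | succ k ih =>
    intro i hi ξ
    have hS := kSC_shortExact y k t (hreg k hk)
    obtain ⟨j, rfl⟩ : ∃ j, i = 1 + j := ⟨i - 1, by omega⟩
    obtain ⟨x₁, hx⟩ := Abelian.Ext.contravariant_sequence_exact₃ hS M ξ
      (ih (by omega) _ (by omega) _) rfl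
    exact hx.symm.trans (ext_comp_eq_zero_right _ _ (ih (by omega) j (by omega) _))

/-- `1 ↦ m` -/
def elt {M : ModuleCat.{0} R} (m : M) : ModuleCat.of R R ⟶ M :=
  ModuleCat.ofHom (LinearMap.toSpanSingleton R M m)

lemma k_surj (y : ℕ → R) (n t : ℕ)
    (hreg : ∀ k < n, IsSMulRegular (R ⧸ kI y k t) (y k ^ t)) (M : ModuleCat.{0} R) (k : ℕ)
    (hk : k ≤ n) : ∀ ξ : Abelian.Ext (kQ y k t) M k,
      ∃ m : M, ξ = (kU y k t).comp (Abelian.Ext.mk₀ (elt m)) (add_zero k) := by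
  induction k with
  | zero =>
    intro ξ
    obtain ⟨φ, rfl⟩ := Abelian.Ext.homEquiv₀.symm.surjective ξ
    refine ⟨φ (Submodule.Quotient.mk (1:R) : R ⧸ kI y 0 t), ?_⟩
    simp only [kU, Abelian.Ext.mk₀_comp_mk₀, Abelian.Ext.homEquiv₀_symm_apply]
    congr 1
    ext
    exact (one_smul R _).symm
  | succ k ih =>
    intro ξ
    have hS := kSC_shortExact y k t (hreg k hk)
    obtain ⟨x₁, hx⟩ := Abelian.Ext.contravariant_sequence_exact₃ hS M ξ
      (k_vanish y n t hreg M k (by omega) _ (by omega) _) (add_comm 1 k)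
    obtain ⟨m, rfl⟩ := ih (by omega) x₁
    refine ⟨m, hx.symm.trans ?_⟩
    rw [kU, kδ_eq _ _ _ hS]
    exact (Abelian.Ext.comp_assoc hS.extClass (kU y k t) (Abelian.Ext.mk₀ (elt m))
      (add_comm 1 k) (add_zero k) (show 1 + k + 0 = k + 1 by omega)).symm

def kMap (y : ℕ → R) (k t s : ℕ) : kSC y k (t+s) ⟶ kSC y k t where
  τ₁ := y k ^ s • canQ (kI_mono y k t s)
  τ₂ := canQ (kI_mono y k t s)
  τ₃ := canQ (kI_mono y (k+1) t s)
  comm₁₂ := by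
    change (y k ^ s • canQ (kI_mono y k t s)) ≫ (y k ^ t • 𝟙 (kQ y k t)) =
      (y k ^ (t+s) • 𝟙 (kQ y k (t+s))) ≫ canQ (kI_mono y k t s)
    simp [smul_smul, pow_add, mul_comm]
  comm₂₃ := by
    change canQ _ ≫ canQ _ = canQ _ ≫ canQ _
    rw [canQ_comp, canQ_comp]

lemma k_trans (y : ℕ → R) (n : ℕ)
    (hreg : ∀ t, ∀ k < n, IsSMulRegular (R ⧸ kI y k t) (y k ^ t)) (t s k : ℕ)
    (hk : k ≤ n) :
    (Abelian.Ext.mk₀ (canQ (kI_mono y k t s))).comp (kU y k t) (zero_add k) =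
      (∏ j ∈ Finset.range k, y j) ^ s • kU y k (t+s) := by
  induction k with
  | zero =>
    simp only [kU, Finset.range_zero, Finset.prod_empty, one_pow, one_smul,
      Abelian.Ext.mk₀_comp_mk₀]
    congr 1
    ext
    rfl
  | succ k ih =>
    have hS := kSC_shortExact y k t (hreg t k hk)
    have hS' := kSC_shortExact y k (t+s) (hreg (t+s) k hk)
    have nat := ShortComplex.ShortExact.extClass_naturality hS' hS (kMap y k t s)
    have nat' : (kδ y k (t+s)).comp (Abelian.Ext.mk₀ (y k ^ s • canQ (kI_mono y k t s)))
      (add_zero 1) = (Abelian.Ext.mk₀ (canQ (kI_mono y (k+1) t s))).comp (kδ y k t) (zero_add 1) := by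
      rw [kδ_eq _ _ _ hS, kδ_eq _ _ _ hS']
      exact nat
    rw [kU, ← Abelian.Ext.comp_assoc _ (kδ y k t) (kU y k t) (zero_add 1) (add_comm 1 k)
      (show 0 + 1 + k = k + 1 by omega), ← nat',
      Abelian.Ext.comp_assoc _ _ (kU y k t) (add_zero 1) (zero_add k)
      (show 1 + 0 + k = k + 1 by omega), Abelian.Ext.mk₀_smul, Abelian.Ext.smul_comp,
      ih (by omega), smul_smul, Abelian.Ext.comp_smul, Finset.prod_range_succ, mul_pow, mul_comm, kU]

/-- vanishing above `n` -/
lemma k_lc_vanish (y : ℕ → R) (n : ℕ) (J : Ideal R) 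
    (hJ : J = Ideal.span (y '' {j | j < n}))
    (hreg : ∀ t, ∀ k < n, IsSMulRegular (R ⧸ kI y k t) (y k ^ t)) (M : ModuleCat.{0} R) (i : ℕ)
    (hi : n < i ∨ (n = i ∧ ∀ t, ∃ s, ∀ v : M, ∃ c ∈ kI y n (t+s), 
      (∏ j ∈ Finset.range n, y j) ^ s • v = c • v)) : 
    ¬ Nontrivial ((localCohomology J i).obj M) := by
  have fg : J.FG := by
    rw [hJ]
    exact ⟨((Set.finite_lt_nat n).image y).toFinset, by simp⟩
  have le1 : ∀ t, kI y n t ≤ J ^ t := by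
    intro t
    unfold kI
    rw [Ideal.span_le]
    rintro _ ⟨j, hj, rfl⟩
    refine Ideal.pow_mem_pow ?_ t
    rw [hJ]
    exact Ideal.subset_span ⟨j, hj, rfl⟩
  have le2 : ∀ t, ∃ t', J ^ t' ≤ kI y n t := by
    intro t
    refine Ideal.exists_pow_le_of_le_radical_of_fg ?_ fg
    rw [hJ, Ideal.span_le]
    rintro _ ⟨j, hj, rfl⟩
    exact ⟨t, Ideal.subset_span ⟨j, hj, rfl⟩⟩
  apply lc_not_nontrivial
  intro t ξ
  have key : ∃ s, (Abelian.Ext.mk₀ (canQ (kI_mono y n t s))).comp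
      ((Abelian.Ext.mk₀ (canQ (le1 t))).comp ξ (zero_add i)) (zero_add i) = 0 := by
    rcases hi with hi | ⟨rfl, hi⟩
    · exact ⟨0, k_vanish y n _ (hreg _) M n le_rfl i hi _⟩
    · obtain ⟨s, hs⟩ := hi t
      refine ⟨s, ?_⟩
      obtain ⟨m, hm⟩ := k_surj y n t (hreg t) M n le_rfl
        ((Abelian.Ext.mk₀ (canQ (le1 t))).comp ξ (zero_add n))
      rw [hm, ← Abelian.Ext.comp_assoc _ (kU y n t) _ (zero_add n) (add_zero n)
        (show 0 + n + 0 = n by omega), k_trans y n hreg t s n le_rfl, Abelian.Ext.smul_comp]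
      obtain ⟨c, hc, hcm⟩ := hs m
      have e : (∏ j ∈ Finset.range n, y j) ^ s • elt m = c • elt m := by
        ext
        change (∏ j ∈ Finset.range n, y j) ^ s • ((1:R) • m) = c • (1:R) • m
        rw [one_smul, hcm]
      rw [← Abelian.Ext.comp_smul, ← Abelian.Ext.mk₀_smul, e, Abelian.Ext.mk₀_smul,
        Abelian.Ext.comp_smul]
      exact ext_smul_zero_left (kQ_ann y n (t+s) c hc) _
  obtain ⟨s, hs⟩ := key
  obtain ⟨t₀, ht₀⟩ := le2 (t+s)
  have ht' : J ^ (max t t₀) ≤ kI y n (t+s) :=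
    (Ideal.pow_le_pow_right (le_max_right _ _)).trans ht₀
  refine ⟨max t t₀, le_max_left _ _, ?_⟩
  have : canQ (Ideal.pow_le_pow_right (I := J) (le_max_left t t₀)) =
      canQ ht' ≫ canQ (kI_mono y n t s) ≫ canQ (le1 t) := by
    rw [canQ_comp, canQ_comp]
  rw [this, ← Abelian.Ext.mk₀_comp_mk₀_assoc, ← Abelian.Ext.mk₀_comp_mk₀_assoc, hs,
    Abelian.Ext.comp_zero]

end Kos


section Seq
variable {R : Type} [CommRing R]

def quotIso {L L' : Ideal R} {x : R} (h : ∀ r, r ∈ L' ↔ ∃ c, r - c * x ∈ L) :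
    QuotSMulTop x (R ⧸ L) ≃ₗ[R] R ⧸ L' :=
  have hle : L ≤ L' := fun r hr => (h r).mpr ⟨0, by simpa using hr⟩
  (Submodule.quotEquivOfEq _ (Submodule.map L.mkQ L') (by
    ext v
    obtain ⟨v, rfl⟩ := Submodule.Quotient.mk_surjective _ v
    rw [Submodule.mem_smul_pointwise_iff_exists]
    constructor
    · rintro ⟨w, -, hw⟩
      obtain ⟨w, rfl⟩ := Submodule.Quotient.mk_surjective _ w
      refine ⟨x * w, (h _).mpr ⟨w, by simp [mul_comm]⟩, ?_⟩
      rw [← hw]; rfl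
    · rintro ⟨r, hr, hrv⟩
      obtain ⟨c, hc⟩ := (h r).mp hr
      refine ⟨Submodule.Quotient.mk c, trivial, ?_⟩
      rw [← hrv, ← Submodule.Quotient.mk_smul]
      change Submodule.Quotient.mk _ = Submodule.Quotient.mk r
      rw [eq_comm, Submodule.Quotient.eq]
      simpa [mul_comm] using hc)).trans
    (Submodule.quotientQuotientEquivQuotient L L' hle)

lemma HG_of_chain (J : Ideal R) (n : ℕ) (L : ℕ → Ideal R) (y : ℕ → R)
    (hy : ∀ k < n, y k ∈ J) (hJ : J ≤ L n) (h1 : (1 : R) ∉ L n)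
    (hL : ∀ k < n, ∀ r, r ∈ L (k+1) ↔ ∃ c, r - c * y k ∈ L k)
    (hreg : ∀ k < n, ∀ r, y k * r ∈ L k → r ∈ L k) (i : ℕ) (hi : i ≤ n) :
    HG J (ModuleCat.of R (R ⧸ L (n - i))) i := by
  induction i with
  | zero =>
    refine HG.base (M := ModuleCat.of R (R ⧸ L n)) (Submodule.Quotient.mk 1 : R ⧸ L n) ?_ ?_
    · intro h; exact h1 ((Submodule.Quotient.mk_eq_zero _).mp h)
    · intro x hx
      change (Submodule.Quotient.mk (x • 1) : R ⧸ L n) = 0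
      rw [Submodule.Quotient.mk_eq_zero]
      simpa using hJ hx
  | succ i ih =>
    have hk : n - (i+1) < n := by omega
    have e : n - (i+1) + 1 = n - i := by omega
    have reg : IsSMulRegular (R ⧸ L (n - (i+1))) (y (n - (i+1))) := by
      rw [isSMulRegular_iff_right_eq_zero_of_smul]
      intro v hv
      obtain ⟨v, rfl⟩ := Submodule.Quotient.mk_surjective _ v
      rw [← Submodule.Quotient.mk_smul, Submodule.Quotient.mk_eq_zero] at hv
      exact (Submodule.Quotient.mk_eq_zero _).mpr (hreg _ hk _ hv)
    refine HG.step (M := ModuleCat.of R (R ⧸ L (n - (i+1)))) (hy _ hk) reg ?_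
    refine HG.of_iso (LinearEquiv.toModuleIso (quotIso (hL _ hk))).symm ?_
    rw [e]
    exact ih (by omega)
end Seq

section Poly
variable {K : Type} [Field K] {m n : ℕ}

/-- the sequence of `y` variables -/
def yv (K : Type) [Field K] (m n : ℕ) (j : ℕ) : BGS K m n :=
  if h : j < n then X (Sum.inr ⟨j, h⟩) else 0

lemma yv_lt {j : ℕ} (h : j < n) : yv K m n j = X (Sum.inr ⟨j, h⟩) := by simp [yv, h]

lemma idealQ_eq : idealQ K m n = Ideal.span (yv K m n '' {j | j < n}) := by
  unfold idealQ
  congr 1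
  ext z
  constructor
  · rintro ⟨j, rfl⟩
    exact ⟨j, j.2, yv_lt j.2⟩
  · rintro ⟨j, hj, rfl⟩
    exact ⟨⟨j, hj⟩, (yv_lt hj).symm⟩

lemma yv_reg (t : ℕ) (k : ℕ) (hk : k < n) :
    IsSMulRegular (BGS K m n ⧸ kI (yv K m n) k t) (yv K m n k ^ t) := by
  have hI : kI (yv K m n) k t = Ideal.span ((fun s => monomial s (1:K)) ''
      {s | ∃ j : Fin n, j.1 < k ∧ s = Finsupp.single (Sum.inr j) t}) := by
    unfold kI
    congr 1
    ext z
    constructor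
    · rintro ⟨j, hj, rfl⟩
      have hj : j < k := hj
      refine ⟨_, ⟨⟨j, hj.trans hk⟩, hj, rfl⟩, ?_⟩
      simp only [yv_lt (hj.trans hk), X_pow_eq_monomial]
    · rintro ⟨_, ⟨j, hj, rfl⟩, rfl⟩
      refine ⟨j, hj, ?_⟩
      simp only [yv_lt j.2, X_pow_eq_monomial]
  rw [isSMulRegular_iff_right_eq_zero_of_smul]
  intro v hv
  obtain ⟨v, rfl⟩ := Submodule.Quotient.mk_surjective _ v
  rw [← Submodule.Quotient.mk_smul, Submodule.Quotient.mk_eq_zero] at hv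
  rw [Submodule.Quotient.mk_eq_zero]
  rw [hI, mem_ideal_span_monomial_image] at hv ⊢
  intro e he
  rw [yv_lt hk, X_pow_eq_monomial] at hv
  obtain ⟨_, ⟨j, hj, rfl⟩, hle⟩ := hv (Finsupp.single (Sum.inr ⟨k, hk⟩) t + e) (by
    rw [mem_support_iff, smul_eq_mul, coeff_monomial_mul, one_mul]
    exact mem_support_iff.mp he)
  refine ⟨_, ⟨j, hj, rfl⟩, ?_⟩
  rw [Finsupp.single_le_iff] at hle ⊢
  have : (Sum.inr (⟨k, hk⟩ : Fin n) : Fin m ⊕ Fin n) ≠ Sum.inr j := by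
    intro h
    have := congrArg Fin.val (Sum.inr.inj h)
    simp at this
    omega
  simpa [Finsupp.single_apply, this] using hle

/-- set the first `k` of the `y` variables to zero -/
def Ek (K : Type) [Field K] (m n : ℕ) (k : ℕ) : BGS K m n →ₐ[K] BGS K m n :=
  aeval (Sum.elim (fun i => X (Sum.inl i)) (fun j : Fin n => if j.1 < k then 0 else X (Sum.inr j)))

/-- set one `y` variable to zero -/
def Fk (K : Type) [Field K] (m n : ℕ) (k : ℕ) : BGS K m n →ₐ[K] BGS K m n :=
  aeval (Sum.elim (fun i => X (Sum.inl i)) (fun j : Fin n => if j.1 = k then 0 else X (Sum.inr j)))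

lemma Ek_zero (g : BGS K m n) : Ek K m n 0 g = g := by
  have : Ek K m n 0 = AlgHom.id K _ := by
    ext i : 1
    rcases i with i | j <;> simp [Ek]
  rw [this]; rfl

lemma Ek_Fk (k : ℕ) (g : BGS K m n) : Ek K m n k (Fk K m n k g) = Ek K m n (k+1) g := by
  have : (Ek K m n k).comp (Fk K m n k) = Ek K m n (k+1) := by
    ext i : 1
    rcases i with i | j
    · simp [Ek, Fk]
    · simp only [Ek, Fk, AlgHom.comp_apply, aeval_X, Sum.elim_inr]
      split_ifs <;> first | omega | simp <;> omega
  exact DFunLike.congr_fun this g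

lemma Ek_Ek (k : ℕ) (g : BGS K m n) : Ek K m n (k+1) (Ek K m n k g) = Ek K m n (k+1) g := by
  have : (Ek K m n (k+1)).comp (Ek K m n k) = Ek K m n (k+1) := by
    ext i : 1
    rcases i with i | j
    · simp [Ek]
    · simp only [Ek, AlgHom.comp_apply, aeval_X, Sum.elim_inr]
      split_ifs <;> first | omega | simp <;> omega
  exact DFunLike.congr_fun this g

lemma Fk_sub (k : ℕ) (hk : k < n) (g : BGS K m n) : ∃ c, g - Fk K m n k g = c * yv K m n k := by
  have : ((Ideal.Quotient.mkₐ K (Ideal.span {yv K m n k})).comp (Fk K m n k)) =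
      Ideal.Quotient.mkₐ K (Ideal.span {yv K m n k}) := by
    ext i : 1
    rcases i with i | j
    · simp [Fk]
    · simp only [Fk, AlgHom.comp_apply, aeval_X, Sum.elim_inr]
      split_ifs with h
      · subst h
        rw [map_zero, eq_comm]
        exact Ideal.Quotient.eq_zero_iff_mem.mpr (by
          rw [yv_lt hk]; exact Ideal.mem_span_singleton_self _)
      · rfl
  have h := DFunLike.congr_fun this g
  have h2 := (Ideal.Quotient.eq.mp h.symm)
  obtain ⟨c, hc⟩ := Ideal.mem_span_singleton'.mp h2
  exact ⟨c, hc.symm⟩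

lemma HG_stable (L : Ideal (BGS K m n)) (h1 : (1 : BGS K m n) ∉ L)
    (hE : ∀ k, ∀ g ∈ L, Ek K m n k g ∈ L)
    (hreg : ∀ j : Fin n, ∀ r, X (Sum.inr j) * r ∈ L → r ∈ L) :
    HG (idealQ K m n) (ModuleCat.of _ (BGS K m n ⧸ L)) n := by
  have hEy : ∀ k (hk : k < n), ∀ k', Ek K m n k' (yv K m n k) = if k < k' then 0 else yv K m n k := by
    intro k hk k'
    simp [yv_lt hk, Ek]
  have := HG_of_chain (idealQ K m n) n (fun k => L.comap (Ek K m n k)) (yv K m n) ?_ ?_ ?_ ?_ ?_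
    n le_rfl
  · have e : L.comap (Ek K m n (n - n)) = L := by
      ext g; simp [Ideal.mem_comap, Ek_zero]
    exact HG.of_iso (LinearEquiv.toModuleIso (Submodule.quotEquivOfEq _ _ e)) this
  · intro k hk
    rw [idealQ_eq]
    exact Ideal.subset_span ⟨k, hk, rfl⟩
  · rw [idealQ_eq, Ideal.span_le]
    rintro _ ⟨j, hj, rfl⟩
    have hj : j < n := hj
    simp [hEy j hj n, hj]
  · simpa [Ideal.mem_comap] using h1
  · intro k hk r
    simp only [Ideal.mem_comap]
    constructor
    · intro h
      obtain ⟨c, hc⟩ := Fk_sub k hk r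
      refine ⟨c, ?_⟩
      rw [← hc]
      simpa [Ek_Fk] using h
    · rintro ⟨c, hc⟩
      have := hE (k+1) _ hc
      rw [Ek_Ek, map_sub, map_mul, hEy k hk, if_pos (Nat.lt_succ_self k)] at this
      simpa using this
  · intro k hk r
    simp only [Ideal.mem_comap, map_mul, hEy k hk, lt_irrefl, if_false]
    intro h
    rw [yv_lt hk] at h
    exact hreg _ _ h

lemma HG_bot : HG (idealQ K m n) (ModuleCat.of _ (BGS K m n ⧸ (⊥ : Ideal (BGS K m n)))) n := by
  apply HG_stable
  · simp
  · intro k g hg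
    simp at hg
    simp [hg]
  · intro j r h
    simpa using h

lemma idealP_ne_one : (1 : BGS K m n) ∉ idealP K m n := by
  intro h
  have : idealP K m n ≤ RingHom.ker (aeval (fun _ => 0) : BGS K m n →ₐ[K] K) := by
    unfold idealP
    rw [Ideal.span_le]
    rintro _ ⟨i, rfl⟩
    simp [RingHom.mem_ker]
  have := this h
  simp [RingHom.mem_ker] at this

lemma HG_P : HG (idealQ K m n) (ModuleCat.of _ (BGS K m n ⧸ idealP K m n)) n := by
  have hP : idealP K m n = Ideal.span (X '' (Set.range Sum.inl)) := by
    unfold idealP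
    rw [← Set.range_comp]; rfl
  apply HG_stable
  · exact idealP_ne_one
  · intro k g hg
    have : idealP K m n ≤ (idealP K m n).comap (Ek K m n k) := by
      conv_lhs => unfold idealP
      rw [Ideal.span_le]
      rintro _ ⟨i, rfl⟩
      simp only [SetLike.mem_coe, Ideal.mem_comap, Ek, aeval_X, Sum.elim_inl]
      exact Ideal.subset_span ⟨i, rfl⟩
    exact this hg
  · intro j r h
    rw [hP, mem_ideal_span_X_image] at h ⊢
    intro e he
    obtain ⟨_, ⟨i, rfl⟩, hi⟩ := h (Finsupp.single (Sum.inr j) 1 + e) (by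
      rw [mem_support_iff, mul_comm, add_comm, coeff_mul_X]
      exact mem_support_iff.mp he)
    refine ⟨_, ⟨i, rfl⟩, ?_⟩
    simpa [Finsupp.single_apply] using hi

end Poly


section Hom
variable {K : Type} [Field K] {σ : Type}

/-- weight-tracking homomorphism -/
def wPhi (w : σ → ℕ) : MvPolynomial σ K →ₐ[K] Polynomial (MvPolynomial σ K) :=
  aeval (fun i => Polynomial.C (X i) * Polynomial.X ^ (w i))

lemma wPhi_monomial (w : σ → ℕ) (e : σ →₀ ℕ) (c : K) :
    wPhi w (monomial e c) =
      Polynomial.C (monomial e c) * Polynomial.X ^ (Finsupp.weight w e) := by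
  have h1 : (algebraMap K (Polynomial (MvPolynomial σ K))) c = Polynomial.C (C c) := rfl
  rw [wPhi, aeval_monomial, h1, monomial_eq, map_mul, mul_assoc]
  congr 1
  simp only [Finsupp.prod, mul_pow, Finset.prod_mul_distrib, map_prod, map_pow]
  congr 1
  simp only [← pow_mul, Finset.prod_pow_eq_pow_sum]
  congr 1
  rw [Finsupp.weight_apply, Finsupp.sum]
  exact Finset.sum_congr rfl fun i _ => by simp [mul_comm]

open Classical in
lemma coeff_wPhi (w : σ → ℕ) (g : MvPolynomial σ K) (k : ℕ) (e : σ →₀ ℕ) :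
    coeff e ((wPhi w g).coeff k) = if Finsupp.weight w e = k then coeff e g else 0 := by
  induction g using MvPolynomial.monomial_add_induction_on with
  | C c => 
    rw [← monomial_zero', wPhi_monomial]
    simp only [Polynomial.coeff_C_mul, Polynomial.coeff_X_pow, map_zero, coeff_monomial]
    by_cases h : e = 0
    · subst h; simp [eq_comm]
      split_ifs <;> simp
    · simp [Ne.symm h]
      split_ifs <;> simp [coeff_C, Ne.symm h]
  | monomial_add a b f ha hb ih =>
    rw [map_add, wPhi_monomial]
    simp only [Polynomial.coeff_add, Polynomial.coeff_C_mul, Polynomial.coeff_X_pow, coeff_add, ih,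
      coeff_monomial]
    by_cases h : a = e
    · subst h
      by_cases h2 : Finsupp.weight w a = k
      · simp [h2]
      · simp [h2, Ne.symm h2]
    · by_cases h2 : k = Finsupp.weight w a
      · simp [h2, h]
      · simp [h2, h]

lemma wPhi_ne_zero (w : σ → ℕ) {g : MvPolynomial σ K} (hg : g ≠ 0) : wPhi w g ≠ 0 := by
  intro h
  apply hg
  ext e
  have := coeff_wPhi w g (Finsupp.weight w e) e
  simpa [h] using this.symm

lemma homog_of_mul (w : σ → ℕ) {g h : MvPolynomial σ K} {d : ℕ} (hne : g * h ≠ 0)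
    (H : IsWeightedHomogeneous w (g * h) d) : ∃ c, IsWeightedHomogeneous w g c := by
  have hg : g ≠ 0 := left_ne_zero_of_mul hne
  have hh : h ≠ 0 := right_ne_zero_of_mul hne
  have e : wPhi w (g * h) = Polynomial.monomial d (g * h) := by
    ext k e
    rw [coeff_wPhi, Polynomial.coeff_monomial]
    by_cases hc : coeff e (g * h) = 0
    · split_ifs <;> simp [hc]
    · rw [H hc]
      split_ifs <;> simp
  have h1 := Polynomial.natDegree_mul (wPhi_ne_zero w hg) (wPhi_ne_zero w hh)
  have h2 := Polynomial.natTrailingDegree_mul (wPhi_ne_zero w hg) (wPhi_ne_zero w hh)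
  rw [← map_mul, e] at h1 h2
  rw [Polynomial.natDegree_monomial_eq _ hne] at h1
  rw [Polynomial.natTrailingDegree_monomial hne] at h2
  have h3 := Polynomial.natTrailingDegree_le_natDegree (wPhi w g)
  have h4 := Polynomial.natTrailingDegree_le_natDegree (wPhi w h)
  refine ⟨(wPhi w g).natDegree, ?_⟩
  intro m hm
  have hc : (wPhi w g).coeff (Finsupp.weight w m) ≠ 0 := by
    intro h0
    have := coeff_wPhi w g (Finsupp.weight w m) m
    rw [h0] at this
    simp at this
    exact hm this.symm
  have h5 := Polynomial.le_natDegree_of_ne_zero hc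
  have h6 := Polynomial.natTrailingDegree_le_of_ne_zero hc
  omega
end Hom

section Bi
variable {K : Type} [Field K] {m n : ℕ}

lemma weight_bwt (e : Fin m ⊕ Fin n →₀ ℕ) :
    Finsupp.weight (bwt m n) e = (∑ i, e (Sum.inl i), ∑ j, e (Sum.inr j)) := by
  rw [Finsupp.weight_apply, Finsupp.sum_fintype _ _ (by simp), Fintype.sum_sum_type]
  simp only [bwt, Sum.elim_inl, Sum.elim_inr]
  ext <;> simp [Prod.fst_sum, Prod.snd_sum]

def wx (m n : ℕ) : Fin m ⊕ Fin n → ℕ := Sum.elim (fun _ => 1) (fun _ => 0)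
def wy (m n : ℕ) : Fin m ⊕ Fin n → ℕ := Sum.elim (fun _ => 0) (fun _ => 1)

lemma weight_wx (e : Fin m ⊕ Fin n →₀ ℕ) :
    Finsupp.weight (wx m n) e = ∑ i, e (Sum.inl i) := by
  rw [Finsupp.weight_apply, Finsupp.sum_fintype _ _ (by simp), Fintype.sum_sum_type]
  simp [wx]

lemma weight_wy (e : Fin m ⊕ Fin n →₀ ℕ) :
    Finsupp.weight (wy m n) e = ∑ i, e (Sum.inr i) := by
  rw [Finsupp.weight_apply, Finsupp.sum_fintype _ _ (by simp), Fintype.sum_sum_type]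
  simp [wy]

lemma bihom_iff (g : BGS K m n) (c d : ℕ) : IsWeightedHomogeneous (bwt m n) g (c, d) ↔
    IsWeightedHomogeneous (wx m n) g c ∧ IsWeightedHomogeneous (wy m n) g d := by
  constructor
  · intro h
    constructor
    · intro e he
      have := h he
      rw [weight_bwt] at this
      rw [weight_wx]; exact congrArg Prod.fst this
    · intro e he
      have := h he
      rw [weight_bwt] at this
      rw [weight_wy]; exact congrArg Prod.snd this
  · rintro ⟨h1, h2⟩ e he
    rw [weight_bwt, ← weight_wx, ← weight_wy, h1 he, h2 he]

lemma bihom_of_mul {g h : BGS K m n} {a b : ℕ} (hne : g * h ≠ 0)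
    (H : IsWeightedHomogeneous (bwt m n) (g * h) (a, b)) :
    ∃ c d c' d', IsWeightedHomogeneous (bwt m n) g (c, d) ∧
      IsWeightedHomogeneous (bwt m n) h (c', d') ∧ c + c' = a ∧ d + d' = b := by
  obtain ⟨H1, H2⟩ := (bihom_iff _ _ _).mp H
  obtain ⟨c, hc⟩ := homog_of_mul _ hne H1
  obtain ⟨d, hd⟩ := homog_of_mul _ hne H2
  rw [mul_comm] at hne H1 H2
  obtain ⟨c', hc'⟩ := homog_of_mul _ hne H1
  obtain ⟨d', hd'⟩ := homog_of_mul _ hne H2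
  refine ⟨c, d, c', d', (bihom_iff _ _ _).mpr ⟨hc, hd⟩, (bihom_iff _ _ _).mpr ⟨hc', hd'⟩, ?_, ?_⟩
  · have := (hc'.mul hc).inj_right hne H1
    omega
  · have := (hd'.mul hd).inj_right hne H2
    omega

lemma mem_P_of_pos {g : BGS K m n} {c d : ℕ} (h : IsWeightedHomogeneous (bwt m n) g (c, d))
    (hc : 0 < c) : g ∈ idealP K m n := by
  have hP : idealP K m n = Ideal.span (X '' (Set.range Sum.inl)) := by
    unfold idealP
    rw [← Set.range_comp]; rfl
  rw [hP, mem_ideal_span_X_image]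
  intro e he
  have := h (mem_support_iff.mp he)
  rw [weight_bwt] at this
  have h1 := congrArg Prod.fst this
  simp only at h1
  by_contra! hcon
  rw [Finset.sum_eq_zero (fun i _ => hcon _ ⟨i, rfl⟩)] at h1
  omega

lemma mem_Q_of_pos {g : BGS K m n} {c d : ℕ} (h : IsWeightedHomogeneous (bwt m n) g (c, d))
    (hd : 0 < d) : g ∈ idealQ K m n := by
  have hP : idealQ K m n = Ideal.span (X '' (Set.range Sum.inr)) := by
    unfold idealQ
    rw [← Set.range_comp]; rfl
  rw [hP, mem_ideal_span_X_image]
  intro e he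
  have := h (mem_support_iff.mp he)
  rw [weight_bwt] at this
  have h1 := congrArg Prod.snd this
  simp only at h1
  by_contra! hcon
  rw [Finset.sum_eq_zero (fun i _ => hcon _ ⟨i, rfl⟩)] at h1
  omega

lemma isUnit_of_zero {g : BGS K m n} (h : IsWeightedHomogeneous (bwt m n) g (0, 0))
    (hg : g ≠ 0) : IsUnit g := by
  have : g = C (coeff 0 g) := by
    ext e
    rw [coeff_C]
    split_ifs with h0
    · rw [h0]
    · by_contra hne
      have := h hne
      rw [weight_bwt, Prod.mk.injEq] at this
      simp only [Finset.sum_eq_zero_iff, Finset.mem_univ, true_imp_iff] at this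
      apply h0
      ext i
      rcases i with i | j
      · exact (this.1 i).symm
      · exact (this.2 j).symm
  rw [this]
  apply IsUnit.map
  rw [isUnit_iff_ne_zero]
  intro h0
  rw [h0] at this
  exact hg (by simpa using this)

lemma Ek_fix {g : BGS K m n} {c : ℕ} (h : IsWeightedHomogeneous (bwt m n) g (c, 0)) (k : ℕ) :
    Ek K m n k g = g := by
  have : (Ek K m n k : BGS K m n →+* BGS K m n) g = (RingHom.id _) g := by
    apply hom_congr_vars
    · ext x; simp
    · rintro i hi -
      rcases i with i | j
      · simp [Ek]
      · exfalso
        obtain ⟨e, he, hj⟩ := (mem_vars _).mp hi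
        have := h (mem_support_iff.mp he)
        rw [weight_bwt, Prod.mk.injEq] at this
        simp only [Finset.sum_eq_zero_iff, Finset.mem_univ, true_imp_iff] at this
        exact (Finsupp.mem_support_iff.mp hj) (this.2 j)
    · rfl
  exact this

lemma HG_xhyp {f : BGS K m n} {a : ℕ} (hf : IsWeightedHomogeneous (bwt m n) f (a, 0))
    (h0 : f ≠ 0) (hu : ¬ IsUnit f) :
    HG (idealQ K m n) (ModuleCat.of _ (BGS K m n ⧸ Ideal.span {f})) n := by
  apply HG_stable
  · rwa [← Ideal.eq_top_iff_one, Ideal.span_singleton_eq_top]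
  · intro k g hg
    rw [Ideal.mem_span_singleton] at hg ⊢
    obtain ⟨c, rfl⟩ := hg
    rw [map_mul, Ek_fix hf]
    exact dvd_mul_right _ _
  · intro j r hr
    rw [Ideal.mem_span_singleton] at hr ⊢
    obtain ⟨c, hc⟩ := hr
    have hp : Prime (X (Sum.inr j) : BGS K m n) := X_prime
    rcases hp.dvd_or_dvd (show X (Sum.inr j) ∣ f * c from ⟨r, hc.symm⟩) with ⟨d, hd⟩ | ⟨d, hd⟩
    · exfalso
      apply h0
      rw [← Ek_fix hf n, hd, map_mul]
      simp [Ek]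
    · refine ⟨d, ?_⟩
      apply mul_left_cancel₀ hp.ne_zero
      rw [hc, hd]; ring

/-- for `f ∈ Q` nonzero the grade drops by one -/
lemma HG_qhyp {f : BGS K m n} (hf : f ∈ idealQ K m n) (h0 : f ≠ 0) {k : ℕ} (hn : n = k + 1) :
    HG (idealQ K m n) (ModuleCat.of _ (BGS K m n ⧸ Ideal.span {f})) k := by
  have h1 : ∀ g, g = n → HG (idealQ K m n)
      (ModuleCat.of _ (BGS K m n ⧸ (⊥ : Ideal (BGS K m n)))) g := by
    rintro _ rfl; exact HG_bot
  replace h1 := h1 (k + 1) hn.symm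
  have reg : IsSMulRegular (BGS K m n ⧸ (⊥ : Ideal (BGS K m n))) f := by
    rw [isSMulRegular_iff_right_eq_zero_of_smul]
    intro v hv
    obtain ⟨v, rfl⟩ := Submodule.Quotient.mk_surjective _ v
    rw [← Submodule.Quotient.mk_smul, Submodule.Quotient.mk_eq_zero] at hv
    rw [Submodule.Quotient.mk_eq_zero]
    simpa [h0] using hv
  have h2 := HG.unstep hf reg h1
  refine HG.of_iso (LinearEquiv.toModuleIso (quotIso ?_)) h2
  intro r
  simp [Ideal.mem_span_singleton', sub_eq_zero, eq_comm]
end Bi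


section Van
variable {K : Type} [Field K] {m n : ℕ}

/-- constant exponent on the `y` variables -/
def oneY (m n T : ℕ) : Fin m ⊕ Fin n →₀ ℕ :=
  Finsupp.equivFunOnFinite.symm (Sum.elim (fun _ => 0) (fun _ => T))

lemma oneY_inl (T : ℕ) (i : Fin m) : oneY m n T (Sum.inl i) = 0 := rfl
lemma oneY_inr (T : ℕ) (i : Fin n) : oneY m n T (Sum.inr i) = T := rfl

lemma exists_monomialOrder (σ : Type) [Fintype σ] : Nonempty (MonomialOrder.{0, 0} σ) := by
  letI : LinearOrder σ := LinearOrder.lift' (Fintype.equivFin σ) (Fintype.equivFin σ).injective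
  haveI : WellFoundedGT σ := Finite.to_wellFoundedGT
  exact ⟨MonomialOrder.lex⟩

lemma van_aux {p : BGS K m n} {β : ℕ} (hp : IsWeightedHomogeneous (bwt m n) p (0, β))
    (h0 : p ≠ 0) (e T : ℕ) (hT : e + β ≤ T) (u d : Fin m ⊕ Fin n →₀ ℕ)
    (hu : ∑ j, u (Sum.inr j) = e) (hd : d + u = oneY m n T) :
    monomial d (1 : K) ∈ kI (yv K m n) n T ⊔ Ideal.span {p} := by
  obtain ⟨o⟩ := exists_monomialOrder (Fin m ⊕ Fin n)
  have hw : ∀ v ∈ p.support, (∀ i, v (Sum.inl i) = 0) ∧ ∑ j, v (Sum.inr j) = β := by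
    intro v hv
    have := hp (mem_support_iff.mp hv)
    rw [weight_bwt, Prod.mk.injEq] at this
    simpa [Finset.sum_eq_zero_iff] using this
  obtain ⟨v, hv, hmin⟩ := Finset.exists_min_image p.support o.toSyn (support_nonempty.mpr h0)
  set L := kI (yv K m n) n T ⊔ Ideal.span {p} with hL
  induction hs : o.toSyn u using WellFoundedLT.induction generalizing u d with
  | ind su ih =>
  subst hs
  have hdi : ∀ i, d i + u i = oneY m n T i := fun i => by rw [← hd]; rfl
  have hvd : v ≤ d := by
    intro i
    rcases i with i | j
    · rw [(hw v hv).1]; exact Nat.zero_le _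
    · have h1 := hdi (Sum.inr j)
      rw [oneY_inr] at h1
      have h2 : u (Sum.inr j) ≤ e := hu ▸ Finset.single_le_sum
        (f := fun j => u (Sum.inr j)) (fun _ _ => Nat.zero_le _) (Finset.mem_univ j)
      have h3 : v (Sum.inr j) ≤ β := (hw v hv).2 ▸ Finset.single_le_sum
        (f := fun j => v (Sum.inr j)) (fun _ _ => Nat.zero_le _) (Finset.mem_univ j)
      omega
  obtain ⟨d0, rfl⟩ : ∃ d0, d = d0 + v := ⟨d - v, (tsub_add_cancel_of_le hvd).symm⟩
  have hpL : p * monomial d0 (1 : K) ∈ L :=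
    L.mul_mem_right _ (Ideal.mem_sup_right (Ideal.mem_span_singleton_self p))
  have hsum : p * monomial d0 (1 : K) = ∑ v' ∈ p.support, monomial (d0 + v') (coeff v' p) := by
    conv_lhs => rw [p.as_sum]
    rw [Finset.sum_mul]
    refine Finset.sum_congr rfl fun v' _ => ?_
    rw [monomial_mul, mul_one, add_comm]
  rw [hsum, ← Finset.add_sum_erase _ _ hv] at hpL
  have hrest : ∑ v' ∈ p.support.erase v, monomial (d0 + v') (coeff v' p) ∈ L := by
    refine Ideal.sum_mem _ fun v' hv' => ?_
    obtain ⟨hne, hv'⟩ := Finset.mem_erase.mp hv'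
    have hC : monomial (d0 + v') (coeff v' p) = C (coeff v' p) * monomial (d0 + v') (1 : K) := by
      rw [C_mul_monomial, mul_one]
    rw [hC]
    apply L.mul_mem_left
    by_cases hle : d0 + v' ≤ oneY m n T
    · obtain ⟨u', hu'⟩ : ∃ u', d0 + v' + u' = oneY m n T :=
        ⟨oneY m n T - (d0 + v'), add_tsub_cancel_of_le hle⟩
      have huv : v' + u' = v + u := by
        apply add_left_cancel (a := d0)
        rw [← add_assoc, ← add_assoc, hu', hd]
      refine ih (o.toSyn u') ?_ u' _ ?_ hu' rfl
      · have h1 : o.toSyn v < o.toSyn v' := lt_of_le_of_ne (hmin v' hv')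
          (fun h => hne (o.toSyn.injective h).symm)
        have h2 : o.toSyn v' + o.toSyn u' = o.toSyn v + o.toSyn u := by
          rw [← map_add, ← map_add, huv]
        by_contra hcon
        exact absurd h2 (add_lt_add_of_lt_of_le h1 (not_lt.mp hcon)).ne'
      · have h1 : ∑ j, (v' + u') (Sum.inr j) = ∑ j, (v + u) (Sum.inr j) := by rw [huv]
        simp only [Finsupp.add_apply, Finset.sum_add_distrib, (hw v hv).2, (hw v' hv').2, hu] at h1
        omega
    · rw [Finsupp.le_def] at hle
      push Not at hle
      obtain ⟨i, hi⟩ := hle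
      rcases i with i | j
      · have h1 := hdi (Sum.inl i)
        rw [oneY_inl] at h1 hi
        have h2 := (hw v' hv').1 i
        simp only [Finsupp.add_apply] at h1 hi
        omega
      · rw [oneY_inr] at hi
        apply Ideal.mem_sup_left
        have hmem : yv K m n j ^ T ∈ kI (yv K m n) n T := Ideal.subset_span ⟨j, j.2, rfl⟩
        refine Ideal.mem_of_dvd _ ?_ hmem
        rw [yv_lt j.2, X_pow_eq_monomial, monomial_dvd_monomial]
        refine ⟨Or.inr ?_, one_dvd _⟩
        rw [Finsupp.single_le_iff]
        exact hi.le
  have hlead := (Submodule.add_mem_iff_left _ hrest).mp hpL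
  have hc : coeff v p ≠ 0 := mem_support_iff.mp hv
  have : monomial (d0 + v) (1 : K) = C (coeff v p)⁻¹ * monomial (d0 + v) (coeff v p) := by
    rw [C_mul_monomial, inv_mul_cancel₀ hc]
  rw [this]
  exact L.mul_mem_left _ hlead

lemma prod_yv_pow (s : ℕ) :
    (∏ j ∈ Finset.range n, yv K m n j) ^ s = monomial (oneY m n s) (1 : K) := by
  rw [Finset.prod_range, ← Finset.prod_pow, monomial_eq, map_one, one_mul,
    Finsupp.prod_fintype _ _ (by simp), Fintype.prod_sum_type]
  simp [oneY_inl, oneY_inr, yv_lt]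

lemma van {p : BGS K m n} {β : ℕ} (hp : IsWeightedHomogeneous (bwt m n) p (0, β))
    (h0 : p ≠ 0) (t : ℕ) : ∃ s, ∀ v : BGS K m n ⧸ Ideal.span {p},
      ∃ c ∈ kI (yv K m n) n (t + s), (∏ j ∈ Finset.range n, yv K m n j) ^ s • v = c • v := by
  refine ⟨n * t + β, ?_⟩
  have := van_aux hp h0 (n * t) (t + (n * t + β)) (by omega) (oneY m n t)
    (oneY m n (n * t + β)) (by simp [oneY_inr]) (by
      ext i; rcases i with i | j
      · simp [oneY_inl]
      · simp [oneY_inr]; omega)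
  rw [← prod_yv_pow] at this
  obtain ⟨c, hc, q, hq, hcq⟩ := Submodule.mem_sup.mp this
  intro v
  refine ⟨c, hc, ?_⟩
  obtain ⟨v, rfl⟩ := Submodule.Quotient.mk_surjective _ v
  rw [← Submodule.Quotient.mk_smul, ← Submodule.Quotient.mk_smul, Submodule.Quotient.eq, ← hcq,
    smul_eq_mul, smul_eq_mul, add_mul, add_sub_cancel_left]
  exact Ideal.mul_mem_right _ _ hq
end Van


section CD
variable {K : Type} [Field K] {m n : ℕ}

lemma PQ_ne_one : (1 : BGS K m n) ∉ idealP K m n ⊔ idealQ K m n := by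
  intro h
  have : idealP K m n ⊔ idealQ K m n ≤ RingHom.ker (aeval (fun _ => 0) : BGS K m n →ₐ[K] K) := by
    rw [sup_le_iff]
    unfold idealP idealQ
    rw [Ideal.span_le, Ideal.span_le]
    constructor <;>
    · rintro _ ⟨i, rfl⟩
      simp [RingHom.mem_ker]
  have := this h
  simp [RingHom.mem_ker] at this

lemma smul_top_lt {L : Ideal (BGS K m n)} (h : (1 : BGS K m n) ∉ L ⊔ idealQ K m n) :
    idealQ K m n • (⊤ : Submodule (BGS K m n) (BGS K m n ⧸ L)) < ⊤ := by
  rw [lt_top_iff_ne_top]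
  intro ht
  apply h
  have h1 : (Submodule.Quotient.mk 1 : BGS K m n ⧸ L) ∈
      idealQ K m n • (⊤ : Submodule (BGS K m n) (BGS K m n ⧸ L)) := by rw [ht]; trivial
  have h2 : idealQ K m n • (⊤ : Submodule (BGS K m n) (BGS K m n ⧸ L)) ≤
      Submodule.map L.mkQ (idealQ K m n) := by
    rw [Submodule.smul_le]
    intro r hr v _
    obtain ⟨v, rfl⟩ := Submodule.Quotient.mk_surjective _ v
    exact ⟨r * v, Ideal.mul_mem_right _ _ hr, rfl⟩
  obtain ⟨c, hc, hc1⟩ := h2 h1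
  have h3 := (Submodule.Quotient.eq L).mp hc1
  have : (1 : BGS K m n) = -(c - 1) + c := by ring
  rw [this]
  exact Ideal.add_mem _ (Ideal.mem_sup_left (neg_mem h3)) (Ideal.mem_sup_right hc)

lemma cohDim_eq {L : Ideal (BGS K m n)} {g : ℕ}
    (h1 : Nontrivial ((localCohomology (idealQ K m n) g).obj (ModuleCat.of _ (BGS K m n ⧸ L))))
    (h2 : ∀ i, g < i →
      ¬ Nontrivial ((localCohomology (idealQ K m n) i).obj (ModuleCat.of _ (BGS K m n ⧸ L)))) :
    cohDim (BGS K m n) (idealQ K m n) (BGS K m n ⧸ L) = g := by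
  have hub : ∀ i ∈ {i : ℕ | Nontrivial ((localCohomology (idealQ K m n) i).obj
      (ModuleCat.of (BGS K m n) (BGS K m n ⧸ L)))}, i ≤ g := by
    intro i hi
    by_contra hlt
    exact h2 i (not_le.mp hlt) hi
  exact le_antisymm (csSup_le ⟨g, h1⟩ hub) (le_csSup ⟨g, hub⟩ h1)

lemma Q_ext_vanish (N : ModuleCat.{0} (BGS K m n))
    (ξ : Abelian.Ext (ModuleCat.of (BGS K m n) (BGS K m n ⧸ idealQ K m n)) N (n + 1)) : ξ = 0 := by
  have hQ : kI (yv K m n) n 1 = idealQ K m n := by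
    rw [idealQ_eq]; unfold kI; simp
  have := k_vanish (yv K m n) n 1 (fun k hk => yv_reg 1 k hk) N n le_rfl (n + 1) (by omega)
  unfold kQ at this
  rw [hQ] at this
  exact this ξ

lemma cohDim_P {L : Ideal (BGS K m n)} (h : L ≤ idealP K m n) :
    cohDim (BGS K m n) (idealQ K m n) (BGS K m n ⧸ L) = n := by
  apply cohDim_eq
  · exact HG.lc_nontrivial_of_surj (HG_P (K := K) (m := m) (n := n)) (smul_top_lt PQ_ne_one)
      (canQ h) (canQ_surj h) Q_ext_vanish
  · intro i hi
    exact k_lc_vanish (yv K m n) n _ idealQ_eq (fun t k hk => yv_reg t k hk) _ i (Or.inl hi)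

lemma cohDim_y {q : BGS K m n} {d k : ℕ} (h : IsWeightedHomogeneous (bwt m n) q (0, d))
    (h0 : q ≠ 0) (hd : 0 < d) (hn : n = k + 1) :
    cohDim (BGS K m n) (idealQ K m n) (BGS K m n ⧸ Ideal.span {q}) = k := by
  have hq := mem_Q_of_pos h hd
  apply cohDim_eq
  · apply HG.lc_nontrivial (HG_qhyp hq h0 hn)
    apply smul_top_lt
    intro h1
    apply PQ_ne_one (K := K) (m := m) (n := n)
    refine (sup_le ?_ ?_ : Ideal.span {q} ⊔ idealQ K m n ≤ idealP K m n ⊔ idealQ K m n) h1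
    · rw [Ideal.span_singleton_le_iff_mem]; exact Ideal.mem_sup_right hq
    · exact le_sup_right
  · intro i hi
    refine k_lc_vanish (yv K m n) n _ idealQ_eq (fun t k hk => yv_reg t k hk) _ i ?_
    rcases Nat.lt_or_ge n i with h' | h'
    · exact Or.inl h'
    · exact Or.inr ⟨by omega, fun t => van h h0 t⟩
end CD

section Ass
variable {R : Type} [CommRing R] [IsDomain R] [IsNoetherianRing R]

lemma mem_ass_of_prime_dvd {f q : R} (h0 : f ≠ 0) (hq : Prime q) (h : q ∣ f) :
    Ideal.span {q} ∈ associatedPrimes R (R ⧸ Ideal.span {f}) := by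
  obtain ⟨g, rfl⟩ := h
  have hg : g ≠ 0 := right_ne_zero_of_mul h0
  have hP : (Ideal.span {q}).IsPrime := (Ideal.span_singleton_prime hq.ne_zero).mpr hq
  rw [AssociatedPrimes.mem_iff, isAssociatedPrime_iff]
  refine ⟨hP, Submodule.Quotient.mk g, ?_⟩
  ext r
  rw [Submodule.mem_colon_singleton, Submodule.mem_bot,
    ← Submodule.Quotient.mk_smul, Submodule.Quotient.mk_eq_zero, Ideal.mem_span_singleton,
    Ideal.mem_span_singleton, smul_eq_mul]
  exact (mul_dvd_mul_iff_right hg).symm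

lemma exists_of_mem_ass [UniqueFactorizationMonoid R] {f : R} (h0 : f ≠ 0) {p : Ideal R}
    (h : p ∈ associatedPrimes R (R ⧸ Ideal.span {f})) :
    ∃ q, Prime q ∧ q ∣ f ∧ p = Ideal.span {q} := by
  rw [AssociatedPrimes.mem_iff, isAssociatedPrime_iff] at h
  obtain ⟨hP, g, hg⟩ := h
  obtain ⟨g, rfl⟩ := Submodule.Quotient.mk_surjective _ g
  obtain ⟨f', g', c, hrel, rfl, rfl⟩ := UniqueFactorizationMonoid.exists_reduced_factors f h0 g
  have hc : c ≠ 0 := left_ne_zero_of_mul h0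
  have hf' : f' ≠ 0 := right_ne_zero_of_mul h0
  have hp : p = Ideal.span {f'} := by
    rw [hg]
    ext r
    rw [Submodule.mem_colon_singleton, Submodule.mem_bot,
      ← Submodule.Quotient.mk_smul, Submodule.Quotient.mk_eq_zero, Ideal.mem_span_singleton,
      Ideal.mem_span_singleton, smul_eq_mul, mul_left_comm, mul_dvd_mul_iff_left hc]
    exact ⟨fun h => hrel.dvd_of_dvd_mul_right h, fun h => h.mul_right _⟩
  refine ⟨f', ?_, dvd_mul_left _ _, hp⟩
  rw [hp] at hP
  exact (Ideal.span_singleton_prime hf').mp hP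

lemma ass_bot {p : Ideal R} : p ∈ associatedPrimes R (R ⧸ Ideal.span {(0 : R)}) ↔ p = ⊥ := by
  have hp : (Ideal.span {(0 : R)}).IsPrime := by
    rw [Ideal.span_singleton_eq_bot.mpr rfl]; exact Ideal.isPrime_bot
  rw [associatedPrimes.eq_singleton_of_isPrimary hp.isPrimary, hp.radical,
    Ideal.span_singleton_eq_bot.mpr rfl, Set.mem_singleton_iff]
end Ass

section Fin
variable {K : Type} [Field K] {m n : ℕ}

lemma mCohDim_const {f : BGS K m n} {g : ℕ} (hu : ¬ IsUnit f)
    (h : ∀ p ∈ associatedPrimes (BGS K m n) (BGS K m n ⧸ Ideal.span {f}),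
      cohDim (BGS K m n) (idealQ K m n) (BGS K m n ⧸ p) = g) :
    mCohDim (BGS K m n) (idealQ K m n) (BGS K m n ⧸ Ideal.span {f}) = g := by
  have : Nontrivial (BGS K m n ⧸ Ideal.span {f}) := by
    rw [Ideal.Quotient.nontrivial_iff]
    rwa [Ne, Ideal.span_singleton_eq_top]
  obtain ⟨p, hp⟩ := associatedPrimes.nonempty (BGS K m n) (BGS K m n ⧸ Ideal.span {f})
  unfold mCohDim
  have hs : (fun p => cohDim (BGS K m n) (idealQ K m n) (BGS K m n ⧸ p)) ''
      associatedPrimes (BGS K m n) (BGS K m n ⧸ Ideal.span {f}) = {g} := by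
    ext x
    constructor
    · rintro ⟨p, hp, rfl⟩; exact h p hp
    · rintro rfl; exact ⟨p, hp, h p hp⟩
  rw [hs, csInf_singleton]

lemma depth_unit {f : BGS K m n} (hu : IsUnit f) :
    HasMaximalDepth (BGS K m n) (idealQ K m n) (BGS K m n ⧸ Ideal.span {f}) := by
  have hs : Subsingleton (BGS K m n ⧸ Ideal.span {f}) := by
    rw [Ideal.Quotient.subsingleton_iff]
    rwa [Ideal.span_singleton_eq_top]
  unfold HasMaximalDepth extGrade mCohDim
  rw [associatedPrimes.eq_empty_of_subsingleton, Set.image_empty, Nat.sInf_empty]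
  have hz : Limits.IsZero (ModuleCat.of (BGS K m n) (BGS K m n ⧸ Ideal.span {f})) :=
    ModuleCat.isZero_of_subsingleton _
  convert Nat.sInf_empty
  rw [Set.eq_empty_iff_forall_notMem]
  intro i hi
  rw [Set.mem_setOf_eq, nontrivial_oExt_iff] at hi
  obtain ⟨ξ, hξ⟩ := exists_ne (0 : Abelian.Ext (ModuleCat.of (BGS K m n) (BGS K m n ⧸ idealQ K m n))
    (ModuleCat.of (BGS K m n) (BGS K m n ⧸ Ideal.span {f})) i)
  apply hξ
  rw [← ξ.comp_mk₀_id, hz.eq_of_src (𝟙 _) 0, Abelian.Ext.mk₀_zero, Abelian.Ext.comp_zero]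

lemma depth_zero :
    HasMaximalDepth (BGS K m n) (idealQ K m n) (BGS K m n ⧸ Ideal.span {(0 : BGS K m n)}) := by
  have h0 : Ideal.span {(0 : BGS K m n)} = ⊥ := Ideal.span_singleton_eq_bot.mpr rfl
  unfold HasMaximalDepth
  rw [mCohDim_const (g := n) not_isUnit_zero, h0, HG_bot.extGrade_eq]
  intro p hp
  rw [ass_bot] at hp
  exact cohDim_P (hp ▸ bot_le)

lemma prime_bihom {f q : BGS K m n} {a b : ℕ} (hf : IsWeightedHomogeneous (bwt m n) f (a, b))
    (h0 : f ≠ 0) (hq : Prime q) (hd : q ∣ f) : ∃ c d c' d' g, f = g * q ∧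
      IsWeightedHomogeneous (bwt m n) g (c, d) ∧ IsWeightedHomogeneous (bwt m n) q (c', d') ∧
      c + c' = a ∧ d + d' = b ∧ (0 < c' ∨ (c' = 0 ∧ 0 < d')) := by
  obtain ⟨g, rfl⟩ := hd
  rw [mul_comm] at hf h0
  obtain ⟨c, d, c', d', h1, h2, h3, h4⟩ := bihom_of_mul h0 hf
  refine ⟨c, d, c', d', g, mul_comm _ _, h1, h2, h3, h4, ?_⟩
  rcases Nat.eq_zero_or_pos c' with rfl | h
  · rcases Nat.eq_zero_or_pos d' with rfl | h
    · exact absurd (isUnit_of_zero h2 hq.ne_zero) hq.not_unit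
    · exact Or.inr ⟨rfl, h⟩
  · exact Or.inl h

lemma depth_x {f : BGS K m n} {a : ℕ} (hf : IsWeightedHomogeneous (bwt m n) f (a, 0))
    (h0 : f ≠ 0) (hu : ¬ IsUnit f) :
    HasMaximalDepth (BGS K m n) (idealQ K m n) (BGS K m n ⧸ Ideal.span {f}) := by
  unfold HasMaximalDepth
  rw [mCohDim_const (g := n) hu, (HG_xhyp hf h0 hu).extGrade_eq]
  intro p hp
  obtain ⟨q, hq, hqf, rfl⟩ := exists_of_mem_ass h0 hp
  obtain ⟨c, d, c', d', g, -, -, h, -, h2, h3⟩ := prime_bihom hf h0 hq hqf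
  apply cohDim_P
  rw [Ideal.span_singleton_le_iff_mem]
  exact mem_P_of_pos h (by omega)

lemma depth_y_iff {f : BGS K m n} {a b : ℕ} (hf : IsWeightedHomogeneous (bwt m n) f (a, b))
    (h0 : f ≠ 0) (hb : 0 < b) :
    HasMaximalDepth (BGS K m n) (idealQ K m n) (BGS K m n ⧸ Ideal.span {f}) ↔
      ∃ q d, Prime q ∧ q ∣ f ∧ IsWeightedHomogeneous (bwt m n) q (0, d) ∧ 0 < d := by
  have hQ := mem_Q_of_pos hf hb
  obtain ⟨k, hn⟩ : ∃ k, n = k + 1 := by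
    rcases n with _ | k
    · exfalso
      apply h0
      simpa [idealQ] using hQ
    · exact ⟨k, rfl⟩
  have hu : ¬ IsUnit f := by
    intro hu
    apply PQ_ne_one (K := K) (m := m) (n := n)
    rw [← Ideal.eq_top_iff_one]
    exact Ideal.eq_top_of_isUnit_mem _ (Ideal.mem_sup_right hQ) hu
  have hg := (HG_qhyp hQ h0 hn).extGrade_eq
  unfold HasMaximalDepth
  rw [hg]
  constructor
  · intro h
    by_contra hcon
    push Not at hcon
    rw [mCohDim_const (g := n) hu] at h
    · omega
    intro p hp
    obtain ⟨q, hq, hqf, rfl⟩ := exists_of_mem_ass h0 hp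
    obtain ⟨c, d, c', d', g, -, -, h, -, h2, h3⟩ := prime_bihom hf h0 hq hqf
    apply cohDim_P
    rw [Ideal.span_singleton_le_iff_mem]
    rcases h3 with h3 | ⟨rfl, h3⟩
    · exact mem_P_of_pos h h3
    · exact absurd h3 (not_lt.mpr (hcon q d' hq hqf h))
  · rintro ⟨q, d, hq, hqf, hqd, hd⟩
    apply le_antisymm
    · apply le_csInf
      · exact ⟨_, _, mem_ass_of_prime_dvd h0 hq hqf, rfl⟩
      · rintro _ ⟨p, hp, rfl⟩
        obtain ⟨q, hq, hqf, rfl⟩ := exists_of_mem_ass h0 hp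
        obtain ⟨c, d, c', d', g, -, -, h, -, h2, h3⟩ := prime_bihom hf h0 hq hqf
        show k ≤ cohDim _ _ _
        rcases h3 with h3 | ⟨rfl, h3⟩
        · rw [cohDim_P]
          · omega
          rw [Ideal.span_singleton_le_iff_mem]
          exact mem_P_of_pos h h3
        · rw [cohDim_y h hq.ne_zero h3 hn]
    · exact Nat.sInf_le ⟨_, mem_ass_of_prime_dvd h0 hq hqf, cohDim_y hqd hq.ne_zero hd hn⟩

lemma prime_of_factor {f h : BGS K m n} {b : ℕ} (h0 : f ≠ 0) (hd : h ∣ f)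
    (hh : IsWeightedHomogeneous (bwt m n) h (0, b)) (hb : 0 < b) :
    ∃ q d, Prime q ∧ q ∣ f ∧ IsWeightedHomogeneous (bwt m n) q (0, d) ∧ 0 < d := by
  have hh0 : h ≠ 0 := ne_zero_of_dvd_ne_zero h0 hd
  have hu : ¬ IsUnit h := by
    intro hu
    apply PQ_ne_one (K := K) (m := m) (n := n)
    rw [← Ideal.eq_top_iff_one]
    exact Ideal.eq_top_of_isUnit_mem _ (Ideal.mem_sup_right (mem_Q_of_pos hh hb)) hu
  obtain ⟨q, hq, hqh⟩ := WfDvdMonoid.exists_irreducible_factor hu hh0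
  obtain ⟨c, e, c', d', g, -, -, h1, h4, h2, h3⟩ := prime_bihom hh hh0 hq.prime hqh
  obtain rfl : c' = 0 := by omega
  exact ⟨q, d', hq.prime, hqh.trans hd, h1, by omega⟩
end Fin


end Helpers

theorem hypersurface_maximalDepth_iff
    (K : Type) [Field K] (m n : ℕ) (f : BGS K m n) (a b : ℕ)
    (hf : IsWeightedHomogeneous (bwt m n) f (a, b)) :
    HasMaximalDepth (BGS K m n) (idealQ K m n) (BGS K m n ⧸ Ideal.span {f}) ↔
      ((∃ (h₁ h₂ h₃ : BGS K m n) (α₁ α₂ β₁ β₂ : ℕ),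
          f = h₁ * h₂ * h₃ ∧
          IsWeightedHomogeneous (bwt m n) h₁ (α₁, 0) ∧ 0 < α₁ ∧
          IsWeightedHomogeneous (bwt m n) h₂ (α₂, β₁) ∧ 0 < α₂ ∧ 0 < β₁ ∧
          IsWeightedHomogeneous (bwt m n) h₃ (0, β₂) ∧ 0 < β₂ ∧
          α₁ + α₂ = a ∧ β₁ + β₂ = b) ∨
        (∃ (h₂ h₃ : BGS K m n) (β₁ β₂ : ℕ),
          f = h₂ * h₃ ∧
          IsWeightedHomogeneous (bwt m n) h₂ (a, β₁) ∧ 0 < a ∧ 0 < β₁ ∧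
          IsWeightedHomogeneous (bwt m n) h₃ (0, β₂) ∧ 0 < β₂ ∧
          β₁ + β₂ = b) ∨
        (∃ (h₁ h₃ : BGS K m n),
          f = h₁ * h₃ ∧
          IsWeightedHomogeneous (bwt m n) h₁ (a, 0) ∧
          IsWeightedHomogeneous (bwt m n) h₃ (0, b))) := by
  by_cases h0 : f = 0
  · subst h0
    refine iff_of_true depth_zero (Or.inr (Or.inr ⟨0, 0, by simp, ?_, ?_⟩)) <;>
      exact isWeightedHomogeneous_zero _ _ _
  have hone : IsWeightedHomogeneous (bwt m n) (1 : BGS K m n) (0, 0) :=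
    isWeightedHomogeneous_one _ _
  rcases Nat.eq_zero_or_pos b with rfl | hb
  · refine iff_of_true ?_ (Or.inr (Or.inr ⟨f, 1, by simp, hf, hone⟩))
    by_cases hu : IsUnit f
    · exact depth_unit hu
    · exact depth_x hf h0 hu
  rw [depth_y_iff hf h0 hb]
  constructor
  · rintro ⟨q, d, hq, hqf, hqd, hd⟩
    obtain ⟨g, rfl⟩ := hqf
    have hne : g * q ≠ 0 := by rwa [mul_comm]
    obtain ⟨c, e, c', e', h1, h2, h3, h4⟩ := bihom_of_mul hne (by rwa [mul_comm])
    have := h2.inj_right hq.ne_zero hqd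
    obtain ⟨rfl, rfl⟩ := Prod.mk.inj this
    simp only [add_zero] at h3
    subst h3
    rcases Nat.eq_zero_or_pos c with rfl | hc
    · exact Or.inr (Or.inr ⟨1, q * g, by simp, hone, hf⟩)
    rcases Nat.eq_zero_or_pos e with rfl | he
    · refine Or.inr (Or.inr ⟨g, q, mul_comm _ _, h1, ?_⟩)
      rw [zero_add] at h4
      rwa [← h4]
    · exact Or.inr (Or.inl ⟨g, q, e, e', mul_comm _ _, h1, hc, he, h2, hd, h4⟩)
  · rintro (⟨h₁, h₂, h₃, α₁, α₂, β₁, β₂, rfl, -, -, -, -, -, H, hp, -⟩ |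
      ⟨h₂, h₃, β₁, β₂, rfl, -, -, -, H, hp, -⟩ | ⟨h₁, h₃, rfl, -, H⟩)
    · exact prime_of_factor h0 (dvd_mul_left _ _) H hp
    · exact prime_of_factor h0 (dvd_mul_left _ _) H hp
    · exact prime_of_factor h0 (dvd_mul_left _ _) H hb
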